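/- Every connected X-induced-minor-free graph of treewidth at most 2 admits a special minimum chordal completion, i.e., a chordal supergraph on the same vertex set whose maximum clique has size 3 (equivalently, treewidth 2) in which no independent set of G of size 3 is a clique. -/

import Mathlib

/-- A tree decomposition of `G`. -/
structure TreeDecomp {V : Type} (G : SimpleGraph V) where
  ι : Type
  tree : SimpleGraph ι
  isTree : tree.IsTree
  bag : ι → Set V
  vert_conn : ∀ v : V, (tree.induce {i | v ∈ bag i}).Connected
  edge_cover : ∀ u v : V, G.Adj u v → ∃ i, u ∈ bag i ∧ v ∈ bag i

/-- Treewidth: minimum over tree decompositions of (max bag size - 1). -/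
noncomputable def treewidth {V : Type} (G : SimpleGraph V) : ℕ :=
  sInf {k | ∃ D : TreeDecomp G, ∀ i, (D.bag i).ncard ≤ k + 1}

/-- A set of vertices is matched if the induced subgraph has a perfect
matching, or a matching missing exactly one vertex that is adjacent to a
matched vertex. -/
def MatchedSet {V : Type} (G : SimpleGraph V) (S : Set V) : Prop :=
  (∃ M : G.Subgraph, M.IsMatching ∧ M.verts = S) ∨
  (∃ (M : G.Subgraph) (v : V), M.IsMatching ∧ v ∈ S ∧ M.verts = S \ {v} ∧
      ∃ u ∈ M.verts, G.Adj v u)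

/-- A matched tree decomposition: every bag is matched. -/
def TreeDecomp.IsMatched {V : Type} {G : SimpleGraph V} (D : TreeDecomp G) : Prop :=
  ∀ i, MatchedSet G (D.bag i)

/-- Matched treewidth. -/
noncomputable def mtw {V : Type} (G : SimpleGraph V) : ℕ :=
  sInf {k | ∃ D : TreeDecomp G, D.IsMatched ∧ ∀ i, (D.bag i).ncard ≤ k + 1}

/-- `H` is an induced minor of `G`: obtained from an induced subgraph of `G`
by contracting connected branch sets. `f v = some w` means `v` belongs to the
branch set of `w`; `f v = none` means `v` is deleted. -/
def IsInducedMinor {V W : Type} (H : SimpleGraph W) (G : SimpleGraph V) : Prop :=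
  ∃ f : V → Option W,
    (∀ w, ∃ v, f v = some w) ∧
    (∀ w, (G.induce {v | f v = some w}).Connected) ∧
    (∀ u v a b, G.Adj u v → f u = some a → f v = some b → a = b ∨ H.Adj a b) ∧
    (∀ a b, H.Adj a b → ∃ u v, f u = some a ∧ f v = some b ∧ G.Adj u v)

/-- `G` contains an induced subgraph isomorphic to `H`. -/
def HasInducedSubgraphIso {V W : Type} (G : SimpleGraph V) (H : SimpleGraph W) : Prop :=
  ∃ S : Set V, Nonempty (H ≃g G.induce S)

/-- Chordal: no induced cycles of length more than 3. -/
def IsChordal {V : Type} (G : SimpleGraph V) : Prop :=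
  ∀ n : ℕ, 4 ≤ n → ¬ HasInducedSubgraphIso G (SimpleGraph.cycleGraph n)

/-- The clique number of a graph. -/
noncomputable def cliqueNumber {V : Type} (G : SimpleGraph V) : ℕ :=
  sSup {n | ∃ s : Finset V, G.IsNClique n s}

/-- A minimum chordal completion: a chordal supergraph on the same vertex set
minimizing the size of the largest clique. -/
def IsMinChordalCompletion {V : Type} (G Gt : SimpleGraph V) : Prop :=
  G ≤ Gt ∧ IsChordal Gt ∧
    ∀ G'' : SimpleGraph V, G ≤ G'' → IsChordal G'' → cliqueNumber Gt ≤ cliqueNumber G''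

/-- A special minimum chordal completion: additionally, no independent set of
size 3 in `G` induces a clique in the completion. -/
def IsSpecialMCC {V : Type} (G Gt : SimpleGraph V) : Prop :=
  IsMinChordalCompletion G Gt ∧
    ∀ a b c : V, a ≠ b → b ≠ c → a ≠ c →
      ¬G.Adj a b → ¬G.Adj b c → ¬G.Adj a c →
      ¬(Gt.Adj a b ∧ Gt.Adj b c ∧ Gt.Adj a c)

/-- The graph `X`: a 6-cycle `u₀…u₅` (vertices `0,…,5`) together with
`u₁' = 6`, `u₃' = 7`, `u₅' = 8`, where `6` is adjacent to `0, 2`, `7` to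
`2, 4`, and `8` to `4, 0`. -/
def graphX : SimpleGraph (Fin 9) :=
  SimpleGraph.fromEdgeSet
    {s(0, 1), s(1, 2), s(2, 3), s(3, 4), s(4, 5), s(5, 0),
     s(0, 6), s(6, 2), s(2, 7), s(7, 4), s(4, 8), s(8, 0)}

/-- `s` is a simplicial vertex of the subgraph of `T` induced by `S`. -/
def SimplicialOn {V : Type} (T : SimpleGraph V) (S : Set V) (s : V) : Prop :=
  s ∈ S ∧ ∀ p ∈ S, ∀ q ∈ S, T.Adj s p → T.Adj s q → p ≠ q → T.Adj p q

/-- Dirac's condition: every vertex set is a clique or has two nonadjacent simplicial vertices. -/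
def Dirac {V : Type} (T : SimpleGraph V) : Prop :=
  ∀ S : Set V, (∀ p ∈ S, ∀ q ∈ S, p ≠ q → T.Adj p q) ∨
    ∃ s t, s ≠ t ∧ ¬ T.Adj s t ∧ SimplicialOn T S s ∧ SimplicialOn T S t

def NoK4 {V : Type} (T : SimpleGraph V) : Prop :=
  ∀ a b c d, T.Adj a b → T.Adj a c → T.Adj a d → T.Adj b c → T.Adj b d → T.Adj c d → False

/-- Adding edges from `u` to the vertices of `N`. -/
def addNbrs {V : Type} (T : SimpleGraph V) (u : V) (N : Set V) : SimpleGraph V where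
  Adj a b := T.Adj a b ∨ (a = u ∧ b ∈ N ∧ b ≠ u) ∨ (b = u ∧ a ∈ N ∧ a ≠ u)
  symm := ⟨fun a b h => by rcases h with h | h | h <;> simp_all [T.adj_comm]⟩
  loopless := ⟨fun a h => by simp at h; grind⟩

/-- Replacing the edge `xy` by a vertex `u` adjacent to `x`, `y` and their common neighbours. -/
def flipEdge {V : Type} (T : SimpleGraph V) (u x y : V) : SimpleGraph V :=
  addNbrs (T.deleteEdges {s(x, y)}) u {w | w = x ∨ w = y ∨ T.Adj x w ∧ T.Adj y w}

theorem addNbrs_adj {V : Type} {T : SimpleGraph V} {u : V} {N : Set V} {a b : V} :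
    (addNbrs T u N).Adj a b ↔ T.Adj a b ∨ (a = u ∧ b ∈ N ∧ b ≠ u) ∨ (b = u ∧ a ∈ N ∧ a ≠ u) :=
  Iff.rfl

theorem flipEdge_adj {V : Type} {T : SimpleGraph V} {u x y a b : V} :
    (flipEdge T u x y).Adj a b ↔ (T.Adj a b ∧ ¬ (a = x ∧ b = y) ∧ ¬ (a = y ∧ b = x)) ∨
      (a = u ∧ (b = x ∨ b = y ∨ T.Adj x b ∧ T.Adj y b) ∧ b ≠ u) ∨
      (b = u ∧ (a = x ∨ a = y ∨ T.Adj x a ∧ T.Adj y a) ∧ a ≠ u) := by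
  simp [flipEdge, addNbrs_adj]

theorem Dirac.of_simplicial {V : Type} {T' T : SimpleGraph V} {u : V} (S : Set V)
    (hd : Dirac T') (heq : ∀ a ∈ S, ∀ b ∈ S, a ≠ u → b ≠ u → (T.Adj a b ↔ T'.Adj a b))
    (hu : u ∈ S → SimplicialOn T S u) :
    (∀ p ∈ S, ∀ q ∈ S, p ≠ q → T.Adj p q) ∨
    ∃ s t, s ≠ t ∧ ¬ T.Adj s t ∧ SimplicialOn T S s ∧ SimplicialOn T S t := by
  have hs : ∀ {a b}, T.Adj a b → T.Adj b a := fun h => h.symm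
  have hs' : ∀ {a b}, T'.Adj a b → T'.Adj b a := fun h => h.symm
  by_cases huS : u ∈ S
  · have hu := hu huS
    rcases hd (S \ {u}) with h | ⟨s, t, hst, hnst, hs1, ht1⟩
    · by_cases hall : ∀ p ∈ S, p ≠ u → T.Adj u p
      · left
        intro p hp q hq hpq
        by_cases h1 : p = u
        · subst h1; exact hall q hq (Ne.symm hpq)
        · by_cases h2 : q = u
          · subst h2; exact (hall p hp h1).symm
          · exact (heq p hp q hq h1 h2).2 (h p ⟨hp, h1⟩ q ⟨hq, h2⟩ hpq)
      · push Not at hall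
        obtain ⟨p, hp, hpu, hn⟩ := hall
        refine .inr ⟨u, p, Ne.symm hpu, hn, hu, hp, fun a ha b hb hpa hpb hab => ?_⟩
        have h1 : a ≠ u := by rintro rfl; exact hn hpa.symm
        have h2 : b ≠ u := by rintro rfl; exact hn hpb.symm
        exact (heq a ha b hb h1 h2).2 (h a ⟨ha, h1⟩ b ⟨hb, h2⟩ hab)
    · have key : ∀ s, SimplicialOn T' (S \ {u}) s → ¬ T.Adj u s →
          s ≠ u ∧ SimplicialOn T S s := by
        rintro s ⟨⟨h1, h2⟩, h3⟩ hn
        refine ⟨h2, h1, fun a ha b hb hpa hpb hab => ?_⟩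
        have h1' : a ≠ u := by rintro rfl; exact hn hpa.symm
        have h2' : b ≠ u := by rintro rfl; exact hn hpb.symm
        exact (heq a ha b hb h1' h2').2 (h3 a ⟨ha, h1'⟩ b ⟨hb, h2'⟩
          ((heq s h1 a ha h2 h1').1 hpa) ((heq s h1 b hb h2 h2').1 hpb) hab)
      right
      by_cases h1 : T.Adj u s
      · by_cases h2 : T.Adj u t
        · exact absurd ((heq s hs1.1.1 t ht1.1.1 hs1.1.2 ht1.1.2).1
            (hu.2 s hs1.1.1 t ht1.1.1 h1 h2 hst)) hnst
        · obtain ⟨h3, h4⟩ := key t ht1 h2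
          exact ⟨u, t, Ne.symm h3, h2, hu, h4⟩
      · obtain ⟨h3, h4⟩ := key s hs1 h1
        exact ⟨u, s, Ne.symm h3, h1, hu, h4⟩
  · have hne : ∀ {a}, a ∈ S → a ≠ u := by rintro a ha rfl; exact huS ha
    rcases hd S with h | ⟨s, t, hst, hnst, hs1, ht1⟩
    · exact .inl fun p hp q hq hpq => (heq p hp q hq (hne hp) (hne hq)).2 (h p hp q hq hpq)
    · have key : ∀ s, SimplicialOn T' S s → SimplicialOn T S s := by
        rintro s ⟨h1, h3⟩
        exact ⟨h1, fun a ha b hb hpa hpb hab => (heq a ha b hb (hne ha) (hne hb)).2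
          (h3 a ha b hb ((heq s h1 a ha (hne h1) (hne ha)).1 hpa)
            ((heq s h1 b hb (hne h1) (hne hb)).1 hpb) hab)⟩
      exact .inr ⟨s, t, hst, fun h => hnst ((heq s hs1.1 t ht1.1 (hne hs1.1) (hne ht1.1)).1 h),
        key s hs1, key t ht1⟩

theorem Dirac.addNbrs {V : Type} {T : SimpleGraph V} {u : V} {N : Set V} (hd : Dirac T)
    (hu : ∀ a, ¬ T.Adj u a) (hN : ∀ p ∈ N, ∀ q ∈ N, p ≠ q → T.Adj p q) :
    Dirac (addNbrs T u N) := by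
  have hs : ∀ {a b}, T.Adj a b → T.Adj b a := fun h => h.symm
  intro S
  refine hd.of_simplicial (u := u) S ?_ ?_
  · intro a _ b _ ha hb
    simp [addNbrs_adj, ha, hb]
  · intro huS
    refine ⟨huS, fun p _ q _ hp hq hpq => ?_⟩
    simp only [addNbrs_adj] at hp hq ⊢
    grind

theorem Dirac.flipEdge {V : Type} {T : SimpleGraph V} {u x y : V} (hd : Dirac T)
    (hu : ∀ a, ¬ T.Adj u a) (hxy : T.Adj x y)
    (hc : ∀ z w, T.Adj x z → T.Adj y z → T.Adj x w → T.Adj y w → z = w) :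
    Dirac (flipEdge T u x y) := by
  have hs : ∀ {a b}, T.Adj a b → T.Adj b a := fun h => h.symm
  have hl : ∀ {a}, ¬ T.Adj a a := fun h => T.irrefl h
  have hux : u ≠ x := by rintro rfl; exact hu _ hxy
  have huy : u ≠ y := by rintro rfl; exact hu _ hxy.symm
  have hxy' := hxy.ne
  intro S
  by_cases hmem : x ∈ S ∧ y ∈ S
  swap
  · refine hd.of_simplicial (u := u) S ?_ ?_
    · intro a ha b hb ha' hb'
      simp only [flipEdge_adj]
      grind
    · intro huS
      refine ⟨huS, fun p hp' q hq' hp hq hpq => ?_⟩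
      simp only [flipEdge_adj] at hp hq ⊢
      grind
  obtain ⟨hxS, hyS⟩ := hmem
  right
  set F := _root_.flipEdge T u x y with hF
  -- simplicial vertices other than common neighbours stay simplicial
  have key : ∀ Z : Set V, (∀ z ∈ Z, T.Adj x z ∧ T.Adj y z ∧ ∀ w ∈ S, T.Adj z w → w = x ∨ w = y) →
      ∀ s, SimplicialOn T ((S \ {u}) \ Z) s → ¬ (T.Adj x s ∧ T.Adj y s) → SimplicialOn F S s := by
    intro Z hZ s ⟨⟨⟨h1, h2⟩, h3⟩, h4⟩ h5
    refine ⟨h1, fun p hp' q hq' hp hq hpq => ?_⟩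
    have h4' : ∀ p ∈ S, ∀ q ∈ S, p ≠ u → q ≠ u → p ∉ Z → q ∉ Z → T.Adj s p → T.Adj s q →
      p ≠ q → T.Adj p q := fun p a q b c d e f => h4 p ⟨⟨a, c⟩, e⟩ q ⟨⟨b, d⟩, f⟩
    have h2 : s ≠ u := h2
    clear h4
    simp only [hF, flipEdge_adj] at hp hq ⊢
    have hxZ : x ∉ Z := fun h => hl (hZ x h).1
    have hyZ : y ∉ Z := fun h => hl (hZ y h).2.1
    by_cases hsx : s = x
    · subst hsx
      have hN : ∀ w ∈ S, T.Adj s w → w ≠ y → T.Adj y w := by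
        intro w hw hsw hwy
        by_cases hwZ : w ∈ Z
        · exact (hZ w hwZ).2.1
        · have hwu : w ≠ u := by rintro rfl; exact hu _ hsw.symm
          exact hs (h4' w hw y hyS hwu huy.symm hwZ hyZ hsw hxy hwy)
      grind
    by_cases hsy : s = y
    · subst hsy
      have hN : ∀ w ∈ S, T.Adj s w → w ≠ x → T.Adj x w := by
        intro w hw hsw hwx
        by_cases hwZ : w ∈ Z
        · exact (hZ w hwZ).1
        · have hwu : w ≠ u := by rintro rfl; exact hu _ hsw.symm
          exact hs (h4' w hw x hxS hwu hux.symm hwZ hxZ hsw hxy.symm hwx)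
      grind
    have hpu : p ≠ u := by grind
    have hqu : q ≠ u := by grind
    have hpZ : p ∉ Z := by
      intro h
      have := hZ p h
      grind
    have hqZ : q ∉ Z := by
      intro h
      have := hZ q h
      grind
    have := h4' p hp' q hq' hpu hqu hpZ hqZ
    grind
  have nadj : ∀ s t, s ≠ u → t ≠ u → ¬ T.Adj s t → ¬ F.Adj s t := by
    intro s t h1 h2 h3
    simp only [hF, flipEdge_adj]
    grind
  have fin : (∀ w ∈ S, w = x ∨ w = y ∨ w = u ∨ (T.Adj x w ∧ T.Adj y w)) →
      ∃ s t, s ≠ t ∧ ¬ F.Adj s t ∧ SimplicialOn F S s ∧ SimplicialOn F S t := by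
    intro hw
    refine ⟨x, y, hxy', ?_, ⟨hxS, ?_⟩, ⟨hyS, ?_⟩⟩
    · simp only [hF, flipEdge_adj]; grind
    · intro p hp' q hq' hp hq hpq
      have := hw p hp'
      have := hw q hq'
      simp only [hF, flipEdge_adj] at hp hq ⊢
      grind
    · intro p hp' q hq' hp hq hpq
      have := hw p hp'
      have := hw q hq'
      simp only [hF, flipEdge_adj] at hp hq ⊢
      grind
  by_cases hz : ∃ z ∈ S, T.Adj x z ∧ T.Adj y z ∧ ∀ w ∈ S, T.Adj z w → w = x ∨ w = y
  · obtain ⟨z, hzS, hz⟩ := hz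
    rcases hd ((S \ {u}) \ {z}) with h | ⟨s, t, hst, hnst, hs1, ht1⟩
    · refine fin fun w hw => ?_
      by_contra hcon
      push Not at hcon
      have hwz : w ≠ z := by rintro rfl; exact hcon.2.2.2 hz.1 hz.2.1
      have hm : w ∈ (S \ {u}) \ {z} := ⟨⟨hw, hcon.2.2.1⟩, hwz⟩
      exact hcon.2.2.2 (h x ⟨⟨hxS, hux.symm⟩, by rintro rfl; exact hl hz.1⟩ w hm (Ne.symm hcon.1))
        (h y ⟨⟨hyS, huy.symm⟩, by rintro rfl; exact hl hz.2.1⟩ w hm (Ne.symm hcon.2.1))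
    · have hZ : ∀ z' ∈ ({z} : Set V), T.Adj x z' ∧ T.Adj y z' ∧
          ∀ w ∈ S, T.Adj z' w → w = x ∨ w = y := by rintro _ rfl; exact hz
      refine ⟨s, t, hst, nadj s t hs1.1.1.2 ht1.1.1.2 hnst, key _ hZ s hs1 ?_, key _ hZ t ht1 ?_⟩
      · exact fun h => hs1.1.2 (hc s z h.1 h.2 hz.1 hz.2.1)
      · exact fun h => ht1.1.2 (hc t z h.1 h.2 hz.1 hz.2.1)
  · have hns : ∀ s, SimplicialOn T ((S \ {u}) \ ∅) s → ¬ (T.Adj x s ∧ T.Adj y s) := by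
      rintro s ⟨⟨⟨h1, h2⟩, -⟩, h3⟩ ⟨h4, h5⟩
      refine hz ⟨s, h1, h4, h5, fun w hw hsw => ?_⟩
      by_contra hcon
      push Not at hcon
      have hwu : w ≠ u := by rintro rfl; exact hu _ hsw.symm
      have e1 := h3 x ⟨⟨hxS, hux.symm⟩, by simp⟩ w ⟨⟨hw, hwu⟩, by simp⟩ h4.symm hsw hcon.1.symm
      have e2 := h3 y ⟨⟨hyS, huy.symm⟩, by simp⟩ w ⟨⟨hw, hwu⟩, by simp⟩ h5.symm hsw hcon.2.symm
      exact hsw.ne (hc s w h4 h5 e1 e2)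
    rcases hd ((S \ {u}) \ ∅) with h | ⟨s, t, hst, hnst, hs1, ht1⟩
    · refine fin fun w hw => ?_
      by_contra hcon
      push Not at hcon
      have hm : w ∈ (S \ {u}) \ ∅ := ⟨⟨hw, hcon.2.2.1⟩, by simp⟩
      exact hcon.2.2.2 (h x ⟨⟨hxS, hux.symm⟩, by simp⟩ w hm (Ne.symm hcon.1))
        (h y ⟨⟨hyS, huy.symm⟩, by simp⟩ w hm (Ne.symm hcon.2.1))
    · exact ⟨s, t, hst, nadj s t hs1.1.1.2 ht1.1.1.2 hnst, key ∅ (by simp) s hs1 (hns s hs1),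
        key ∅ (by simp) t ht1 (hns t ht1)⟩

theorem NoK4.flipEdge {V : Type} {T : SimpleGraph V} {u x y : V} (hk : NoK4 T)
    (hu : ∀ a, ¬ T.Adj u a) (hxy : T.Adj x y)
    (hc : ∀ z w, T.Adj x z → T.Adj y z → T.Adj x w → T.Adj y w → z = w) :
    NoK4 (flipEdge T u x y) := by
  have hs : ∀ {a b}, T.Adj a b → T.Adj b a := fun h => h.symm
  have hl : ∀ {a}, ¬ T.Adj a a := fun h => T.irrefl h
  have hxy' := hxy.ne
  have tri : ∀ b c d, (_root_.flipEdge T u x y).Adj u b → (_root_.flipEdge T u x y).Adj u c →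
      (_root_.flipEdge T u x y).Adj u d → (_root_.flipEdge T u x y).Adj b c →
      (_root_.flipEdge T u x y).Adj b d → (_root_.flipEdge T u x y).Adj c d → False := by
    intro b c d
    simp only [flipEdge_adj]
    intro h1 h2 h3 h4 h5 h6
    have e1 : b = x ∨ b = y ∨ T.Adj x b ∧ T.Adj y b := by grind
    have e2 : c = x ∨ c = y ∨ T.Adj x c ∧ T.Adj y c := by grind
    have e3 : d = x ∨ d = y ∨ T.Adj x d ∧ T.Adj y d := by grind
    clear h1 h2 h3
    rcases e1 with rfl | rfl | e1 <;> rcases e2 with rfl | rfl | e2 <;>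
      rcases e3 with rfl | rfl | e3 <;> grind
  intro a b c d h1 h2 h3 h4 h5 h6
  by_cases ha : a = u
  · subst ha; exact tri b c d h1 h2 h3 h4 h5 h6
  by_cases hb : b = u
  · subst hb; exact tri a c d h1.symm h4 h5 h2 h3 h6
  by_cases hc : c = u
  · subst hc; exact tri a b d h2.symm h4.symm h6 h1 h3 h5
  by_cases hd : d = u
  · subst hd; exact tri a b c h3.symm h5.symm h6.symm h1 h2 h4
  simp only [flipEdge_adj] at h1 h2 h3 h4 h5 h6
  exact hk a b c d (by grind) (by grind) (by grind) (by grind) (by grind) (by grind)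

theorem NoK4.addNbrs {V : Type} {T : SimpleGraph V} {u x y : V} (hk : NoK4 T)
    (hu : ∀ a, ¬ T.Adj u a) :
    NoK4 (addNbrs T u {x, y}) := by
  have hs : ∀ {a b}, T.Adj a b → T.Adj b a := fun h => h.symm
  have hl : ∀ {a}, ¬ T.Adj a a := fun h => T.irrefl h
  intro a b c d h1 h2 h3 h4 h5 h6
  have := h1.ne; have := h2.ne; have := h3.ne; have := h4.ne; have := h5.ne; have := h6.ne
  simp only [addNbrs_adj, Set.mem_insert_iff, Set.mem_singleton_iff] at h1 h2 h3 h4 h5 h6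
  by_cases ha : a = u
  · grind
  by_cases hb : b = u
  · grind
  by_cases hc : c = u
  · grind
  by_cases hd : d = u
  · grind
  exact hk a b c d (by grind) (by grind) (by grind) (by grind) (by grind) (by grind)

open Fin.CommRing in
theorem Dirac.isChordal {V : Type} {T : SimpleGraph V} (hd : Dirac T) : IsChordal T := by
  rintro n hn ⟨S, ⟨e⟩⟩
  have hadj : ∀ i j : Fin n, T.Adj (e i) (e j) ↔ (SimpleGraph.cycleGraph n).Adj i j := by
    intro i j
    rw [← e.map_adj_iff]; rfl
  obtain ⟨m, rfl⟩ : ∃ m, n = m + 4 := ⟨n - 4, by omega⟩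
  have hno : ∀ i : Fin (m + 4), (i + 1) ≠ (i - 1) ∧
      ¬ (SimpleGraph.cycleGraph (m + 4)).Adj (i + 1) (i - 1) ∧
      (SimpleGraph.cycleGraph (m + 4)).Adj i (i + 1) ∧
      (SimpleGraph.cycleGraph (m + 4)).Adj i (i - 1) := by
    intro i
    have h2 : (2 : Fin (m + 4)) ≠ 0 := by
      rw [Ne, Fin.ext_iff]
      change ¬ (2 % (m + 4) = 0)
      rw [Nat.mod_eq_of_lt (by omega)]; omega
    have h1 : (1 : Fin (m + 4)) ≠ 0 := by
      rw [Ne, Fin.ext_iff]; simp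
    have h3 : (3 : Fin (m + 4)) ≠ 0 := by
      rw [Ne, Fin.ext_iff]
      change ¬ (3 % (m + 4) = 0)
      rw [Nat.mod_eq_of_lt (by omega)]; omega
    simp only [SimpleGraph.cycleGraph_adj]
    have e1 : i + 1 - (i - 1) = 2 := by ring
    have e2 : i - 1 - (i + 1) = -2 := by ring
    refine ⟨fun h => h2 ?_, ?_, ?_, ?_⟩
    · rw [← e1, h, sub_self]
    · rw [e1, e2]
      rintro (h | h)
      · apply h1
        have : (2 : Fin (m + 4)) - 1 = 0 := by rw [h]; ring
        rw [← this]; ring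
      · apply h3
        have : (-2 : Fin (m + 4)) - 1 = 0 := by rw [h]; ring
        have h' : (3 : Fin (m + 4)) = -(-2 - 1) := by ring
        rw [h', this]; ring
    · right; ring
    · left; ring
  rcases hd S with h | ⟨s, _, _, _, ⟨h1, h2⟩, _⟩
  · obtain ⟨h1, h2, -⟩ := hno 0
    refine h2 ((hadj _ _).1 (h _ (e _).2 _ (e _).2 fun h3 => h1 (e.injective (Subtype.ext h3))))
  · obtain ⟨i, hi⟩ := e.surjective ⟨s, h1⟩
    have hi' : s = e i := by rw [hi]
    subst hi'
    obtain ⟨h3, h4, h5, h6⟩ := hno i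
    exact h4 ((hadj _ _).1 (h2 _ (e _).2 _ (e _).2 ((hadj _ _).2 h5) ((hadj _ _).2 h6)
      fun h => h3 (e.injective (Subtype.ext h))))

/-- `H` has a tree decomposition of width at most two; vertices may lie in no bag. -/
def HasWidthTwo {V : Type} (H : SimpleGraph V) : Prop :=
  ∃ (ι : Type) (tree : SimpleGraph ι) (bag : ι → Set V), tree.IsTree ∧
    (∀ v : V, (tree.induce {i | v ∈ bag i}).Preconnected) ∧
    (∀ u v : V, H.Adj u v → ∃ i, u ∈ bag i ∧ v ∈ bag i) ∧ ∀ i, (bag i).ncard ≤ 3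

theorem hasWidthTwo_of_treewidth {V : Type} [Fintype V] {G : SimpleGraph V}
    (h : treewidth G ≤ 2) : HasWidthTwo G := by
  have hne : {k | ∃ D : TreeDecomp G, ∀ i, (D.bag i).ncard ≤ k + 1}.Nonempty := by
    refine ⟨Fintype.card V, ⟨Unit, ⊥, ?_, fun _ => Set.univ, ?_, ?_⟩, ?_⟩
    · exact ⟨⟨fun a b => by cases a; cases b; exact .rfl⟩,
        SimpleGraph.isAcyclic_bot⟩
    · intro v
      have : Nonempty {i : Unit | v ∈ (Set.univ : Set V)} := ⟨⟨(), trivial⟩⟩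
      refine ⟨fun a b => ?_⟩
      have : a = b := Subsingleton.elim _ _
      rw [this]
    · exact fun u v _ => ⟨(), trivial, trivial⟩
    · intro i
      simp [Set.ncard_univ]
  obtain ⟨D, hD⟩ := Nat.sInf_mem hne
  exact ⟨D.ι, D.tree, D.bag, D.isTree, fun v => (D.vert_conn v).preconnected, D.edge_cover,
    fun i => (hD i).trans (by unfold treewidth at h; omega)⟩

theorem reachable_induce_mono {U : Type} {G : SimpleGraph U} {s t : Set U} (h : s ⊆ t)
    {a b : U} (ha : a ∈ s) (hb : b ∈ s) (hr : (G.induce s).Reachable ⟨a, ha⟩ ⟨b, hb⟩) :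
    (G.induce t).Reachable ⟨a, h ha⟩ ⟨b, h hb⟩ :=
  hr.map (SimpleGraph.induceHomOfLE G h).toHom

/-- Contracting the edge `ux` into `x` preserves width two. -/
theorem HasWidthTwo.contract {V : Type} [Finite V] {H H' : SimpleGraph V} {u x : V}
    (hw : HasWidthTwo H) (hux : H.Adj u x)
    (hsub : ∀ a b, H'.Adj a b → a ≠ u ∧ b ≠ u ∧
      (H.Adj a b ∨ (a = x ∧ H.Adj u b) ∨ (b = x ∧ H.Adj u a))) : HasWidthTwo H' := by
  classical
  obtain ⟨ι, tree, bag, htree, hconn, hcov, hcard⟩ := hw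
  let π : V → V := fun v => if v = u then x else v
  have hxu : x ≠ u := hux.ne.symm
  refine ⟨ι, tree, fun i => π '' bag i, htree, ?_, ?_, ?_⟩
  · intro v
    by_cases hv : v = x
    · subst hv
      have hset : {i | v ∈ π '' bag i} = {i | v ∈ bag i} ∪ {i | u ∈ bag i} := by
        ext i
        simp only [Set.mem_image, Set.mem_ofPred_eq, Set.mem_union, π]
        constructor
        · rintro ⟨w, hw, h⟩
          split_ifs at h <;> simp_all
        · rintro (h | h)
          · exact ⟨v, h, by simp [hxu]⟩
          · exact ⟨u, h, by simp⟩
      rw [hset]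
      obtain ⟨i, hi1, hi2⟩ := hcov u v hux
      have key : ∀ j : ι, ∀ hj : j ∈ {i | v ∈ bag i} ∪ {i | u ∈ bag i},
          (tree.induce ({i | v ∈ bag i} ∪ {i | u ∈ bag i})).Reachable ⟨j, hj⟩ ⟨i, .inl hi2⟩ := by
        rintro j (hj | hj)
        · exact reachable_induce_mono Set.subset_union_left hj hi2 (hconn v ⟨j, hj⟩ ⟨i, hi2⟩)
        · exact reachable_induce_mono Set.subset_union_right hj hi1 (hconn u ⟨j, hj⟩ ⟨i, hi1⟩)
      rintro ⟨a, ha⟩ ⟨b, hb⟩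
      exact (key a ha).trans (key b hb).symm
    · by_cases hvu : v = u
      · rintro ⟨a, w, hw, h⟩
        simp only [π] at h
        split_ifs at h <;> simp_all
      · have hset : {i | v ∈ π '' bag i} = {i | v ∈ bag i} := by
          ext i
          simp only [Set.mem_image, Set.mem_ofPred_eq, π]
          constructor
          · rintro ⟨w, hw, h⟩
            split_ifs at h <;> simp_all
          · exact fun h => ⟨v, h, by simp [hvu]⟩
        rw [hset]
        exact hconn v
  · intro a b hab
    obtain ⟨ha, hb, h | ⟨rfl, h⟩ | ⟨rfl, h⟩⟩ := hsub a b hab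
    · obtain ⟨i, h1, h2⟩ := hcov a b h
      exact ⟨i, ⟨a, h1, by simp [π, ha]⟩, ⟨b, h2, by simp [π, hb]⟩⟩
    · obtain ⟨i, h1, h2⟩ := hcov u b h
      exact ⟨i, ⟨u, h1, by simp [π]⟩, ⟨b, h2, by simp [π, hb]⟩⟩
    · obtain ⟨i, h1, h2⟩ := hcov u a h
      exact ⟨i, ⟨a, h2, by simp [π, ha]⟩, ⟨u, h1, by simp [π]⟩⟩
  · exact fun i => (Set.ncard_image_le (Set.toFinite _)).trans (hcard i)

/-- In a rooted tree, a connected set `B` reaches each of its members through its top node. -/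
theorem exists_top_path {ι : Type} {tree : SimpleGraph ι} (r : ι) (ht : tree.IsTree)
    {B : Set ι} (hB : (tree.induce B).Preconnected) (hne : B.Nonempty) :
    ∃ t ∈ B, (∀ j ∈ B, tree.dist r t ≤ tree.dist r j) ∧ ∀ i ∈ B, ∃ p : tree.Walk r i,
      p.IsPath ∧ p.getVert (tree.dist r t) = t ∧
        ∀ n, tree.dist r t ≤ n → p.getVert n ∈ B := by
  classical
  obtain ⟨t, htB, hmin⟩ : ∃ t ∈ B, ∀ j ∈ B, tree.dist r t ≤ tree.dist r j := by
    obtain ⟨t, h1, h2⟩ := (measure fun j => tree.dist r j).wf.has_min B hne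
    exact ⟨t, h1, fun j hj => not_lt.1 (h2 j hj)⟩
  refine ⟨t, htB, hmin, fun i hi => ?_⟩
  obtain ⟨p, hp, hplen⟩ := ht.1.exists_path_of_dist r t
  obtain ⟨q, hq⟩ := (hB ⟨t, htB⟩ ⟨i, hi⟩).exists_isPath
  let q' : tree.Walk t i := q.map (SimpleGraph.Embedding.induce B).toHom
  have hq' : q'.IsPath := hq.map (SimpleGraph.Embedding.induce (G := tree) B).injective
  have hq'B : ∀ v ∈ q'.support, v ∈ B := by
    intro v hv
    rw [show q'.support = _ from SimpleGraph.Walk.support_map _ q] at hv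
    obtain ⟨w, -, rfl⟩ := List.mem_map.1 hv
    exact w.2
  have hdisj : ∀ v, v ∈ p.support → v ∈ B → v = t := by
    intro v hv hvB
    have h1 := hmin v hvB
    have h2 : (p.takeUntil v hv).length + (p.dropUntil v hv).length = p.length := by
      rw [← SimpleGraph.Walk.length_append, SimpleGraph.Walk.take_spec]
    have h3 := SimpleGraph.dist_le (p.takeUntil v hv)
    exact SimpleGraph.Walk.eq_of_length_eq_zero (p := p.dropUntil v hv) (by omega)
  refine ⟨p.append q', ?_, ?_, ?_⟩
  · rw [SimpleGraph.Walk.isPath_def, SimpleGraph.Walk.support_append]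
    rw [List.nodup_append]
    refine ⟨hp.support_nodup, hq'.support_nodup.tail, ?_⟩
    rintro a ha b hb rfl
    have hat := hdisj a ha (hq'B a (List.mem_of_mem_tail hb))
    subst hat
    have := hq'.support_nodup
    rw [← SimpleGraph.Walk.cons_tail_support] at this
    exact (List.nodup_cons.1 this).1 hb
  · rw [SimpleGraph.Walk.getVert_append, hplen]
    simp
  · intro n hn
    rw [SimpleGraph.Walk.getVert_append, hplen, if_neg (by omega)]
    exact hq'B _ (SimpleGraph.Walk.getVert_mem_support _ _)

theorem HasWidthTwo.exists_low_degree {V : Type} [Finite V] {H : SimpleGraph V}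
    (hw : HasWidthTwo H) {a₀ b₀ : V} (hab : H.Adj a₀ b₀) :
    ∃ v x y, H.Adj v x ∧ H.Adj v y ∧ ∀ a, H.Adj v a → a = x ∨ a = y := by
  classical
  obtain ⟨ι, tree, bag, htree, hconn, hcov, hcard⟩ := hw
  obtain ⟨r⟩ := htree.1.nonempty
  have top := fun (v : {v : V // ∃ w, H.Adj v w}) =>
    exists_top_path r htree (hconn v.1) (by
      obtain ⟨w, hw⟩ := v.2
      obtain ⟨i, hi, -⟩ := hcov _ _ hw
      exact ⟨i, hi⟩)
  choose t htB hmin hpath using top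
  have : Nonempty {v : V // ∃ w, H.Adj v w} := ⟨⟨a₀, b₀, hab⟩⟩
  obtain ⟨⟨v, z, hz⟩, hv⟩ := Finite.exists_max fun v : {v : V // ∃ w, H.Adj v w} =>
    tree.dist r (t v)
  set v' : {v : V // ∃ w, H.Adj v w} := ⟨v, z, hz⟩ with hv'
  have hnb : H.neighborSet v ⊆ bag (t v') \ {v} := by
    intro w hw
    refine ⟨?_, fun h => hw.ne h.symm⟩
    obtain ⟨i, hi1, hi2⟩ := hcov v w hw
    obtain ⟨p, hp, hp1, hp2⟩ := hpath v' i hi1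
    obtain ⟨q, hq, hq1, hq2⟩ := hpath ⟨w, v, hw.symm⟩ i hi2
    have : p = q := by
      have := (htree.2.subsingleton_path r i).elim ⟨p, hp⟩ ⟨q, hq⟩
      exact congrArg Subtype.val this
    have h := hq2 _ (hv ⟨w, v, hw.symm⟩)
    rw [← this, hp1] at h
    exact h
  have hvB : v ∈ bag (t v') := htB v'
  have hc : (H.neighborSet v).ncard ≤ 2 := by
    have h1 := Set.ncard_le_ncard hnb (Set.toFinite _)
    have h2 := Set.ncard_sdiff_singleton_of_mem hvB
    have h3 := hcard (t v')
    omega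
  by_cases hy : ∃ y, H.Adj v y ∧ y ≠ z
  · obtain ⟨y, hy, hyz⟩ := hy
    refine ⟨v, z, y, hz, hy, fun a ha => ?_⟩
    by_contra hcon
    push Not at hcon
    have : ({a, z, y} : Set V) ⊆ H.neighborSet v := by
      rintro b (rfl | rfl | rfl) <;> assumption
    have h1 := Set.ncard_le_ncard this (Set.toFinite _)
    rw [Set.ncard_eq_three.2 ⟨a, z, y, hcon.1, hcon.2, Ne.symm hyz, rfl⟩] at h1
    omega
  · push Not at hy
    exact ⟨v, z, z, hz, hz, fun a ha => .inl (hy a ha)⟩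

/-- Induced minors in which branch sets of isolated vertices may be empty. -/
def IsWeakInducedMinor {U W : Type} (H : SimpleGraph W) (G : SimpleGraph U) : Prop :=
  ∃ f : U → Option W,
    (∀ w, (G.induce {v | f v = some w}).Preconnected) ∧
    (∀ u v a b, G.Adj u v → f u = some a → f v = some b → a = b ∨ H.Adj a b) ∧
    (∀ a b, H.Adj a b → ∃ u v, f u = some a ∧ f v = some b ∧ G.Adj u v)

/-- One step inside the vertex set `S`. -/
def StepIn {U : Type} (G : SimpleGraph U) (S : Set U) (a b : U) : Prop :=
  G.Adj a b ∧ a ∈ S ∧ b ∈ S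

theorem exists_reachable_of_stepIn {U : Type} {G : SimpleGraph U} {S : Set U} {a b : U}
    (h : Relation.ReflTransGen (StepIn G S) a b) (ha : a ∈ S) :
    ∃ hb : b ∈ S, (G.induce S).Reachable ⟨a, ha⟩ ⟨b, hb⟩ := by
  induction h with
  | refl => exact ⟨ha, .rfl⟩
  | tail _ h ih =>
    obtain ⟨hb, hr⟩ := ih
    exact ⟨h.2.2, hr.trans (SimpleGraph.Adj.reachable (by simpa using h.1))⟩

theorem stepIn_of_reachable {U : Type} {G : SimpleGraph U} {S : Set U} {a b : S}
    (h : (G.induce S).Reachable a b) : Relation.ReflTransGen (StepIn G S) a b := by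
  obtain ⟨p⟩ := h
  induction p with
  | nil => exact .refl
  | @cons u v w h _ ih => exact .head ⟨h, u.2, v.2⟩ ih

theorem preconnected_of_center {U : Type} {G : SimpleGraph U} {S : Set U} (c : U)
    (h : ∀ v ∈ S, Relation.ReflTransGen (StepIn G S) v c) : (G.induce S).Preconnected := by
  rintro ⟨a, ha⟩ ⟨b, hb⟩
  obtain ⟨hc, h1⟩ := exists_reachable_of_stepIn (h a ha) ha
  obtain ⟨_, h2⟩ := exists_reachable_of_stepIn (h b hb) hb
  exact h1.trans h2.symm

theorem IsWeakInducedMinor.trans {U V W : Type} {K : SimpleGraph W} {H : SimpleGraph V}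
    {G : SimpleGraph U} (h₁ : IsWeakInducedMinor K H) (h₂ : IsWeakInducedMinor H G) :
    IsWeakInducedMinor K G := by
  obtain ⟨g, g1, g2, g3⟩ := h₁
  obtain ⟨f, f1, f2, f3⟩ := h₂
  refine ⟨fun v => (f v).bind g, ?_, ?_, ?_⟩
  · intro w
    have within : ∀ u v a, f u = some a → f v = some a → g a = some w →
        Relation.ReflTransGen (StepIn G {v | (f v).bind g = some w}) u v := by
      intro u v a hu hv ha
      have h := stepIn_of_reachable (f1 a ⟨u, hu⟩ ⟨v, hv⟩)
      refine Relation.ReflTransGen.mono ?_ _ _ h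
      rintro p q ⟨h, hp, hq⟩
      simp only [Set.mem_ofPred_eq] at hp hq
      exact ⟨h, by simp [hp, ha], by simp [hq, ha]⟩
    rintro ⟨u, hu⟩ ⟨v, hv⟩
    obtain ⟨a, ha, ha'⟩ := Option.bind_eq_some_iff.1 hu
    obtain ⟨b, hb, hb'⟩ := Option.bind_eq_some_iff.1 hv
    have hab := stepIn_of_reachable (g1 w ⟨a, ha'⟩ ⟨b, hb'⟩)
    have key : Relation.ReflTransGen (StepIn G {v | (f v).bind g = some w}) u v := by
      have : ∀ b', Relation.ReflTransGen (StepIn H {v | g v = some w}) a b' →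
          ∀ v', f v' = some b' → g b' = some w →
          Relation.ReflTransGen (StepIn G {v | (f v).bind g = some w}) u v' := by
        intro b' h
        induction h with
        | refl => exact fun v' hv' hg => within _ _ _ ha hv' hg
        | tail _ h ih =>
          intro v' hv' hg
          obtain ⟨p, q, hp, hq, hpq⟩ := f3 _ _ h.1
          refine ((ih p hp h.2.1).tail ⟨hpq, ?_, ?_⟩).trans (within _ _ _ hq hv' hg)
          · have := h.2.1; simp_all
          · simp_all
      exact this b hab v hb hb'
    exact (exists_reachable_of_stepIn key hu).2
  · intro u v a b huv hu hv
    obtain ⟨a', ha, ha'⟩ := Option.bind_eq_some_iff.1 hu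
    obtain ⟨b', hb, hb'⟩ := Option.bind_eq_some_iff.1 hv
    rcases f2 u v a' b' huv ha hb with rfl | h
    · left; simp_all
    · exact g2 a' b' a b h ha' hb'
  · intro a b hab
    obtain ⟨p, q, hp, hq, hpq⟩ := g3 a b hab
    obtain ⟨u, v, hu, hv, huv⟩ := f3 p q hpq
    exact ⟨u, v, by simp [hu, hp], by simp [hv, hq], huv⟩

theorem IsWeakInducedMinor.isInducedMinor {U W : Type} {H : SimpleGraph W} {G : SimpleGraph U}
    (h : IsWeakInducedMinor H G) (hH : ∀ w, ∃ w', H.Adj w w') : IsInducedMinor H G := by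
  obtain ⟨f, f1, f2, f3⟩ := h
  have hne : ∀ w, ∃ v, f v = some w := fun w => by
    obtain ⟨w', hw⟩ := hH w
    obtain ⟨u, -, hu, -⟩ := f3 _ _ hw
    exact ⟨u, hu⟩
  refine ⟨f, hne, fun w => ?_, f2, f3⟩
  obtain ⟨v, hv⟩ := hne w
  have : Nonempty {v | f v = some w} := ⟨⟨v, hv⟩⟩
  exact ⟨f1 w⟩

/-- A graph in which a pair of vertices may be joined by an edge and by up to two paths of
length two whose middle vertices are left implicit. -/
structure LinkGraph (V : Type) where
  edge : SimpleGraph V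
  link : Bool → SimpleGraph V

namespace LinkGraph

variable {V : Type}

/-- The graph of all pairs joined by an edge or a path. -/
def tot (L : LinkGraph V) : SimpleGraph V where
  Adj a b := L.edge.Adj a b ∨ ∃ i, (L.link i).Adj a b
  symm := ⟨fun _ _ h => h.imp (fun h => h.symm) (fun ⟨i, h⟩ => ⟨i, h.symm⟩)⟩
  loopless := ⟨fun _ h => h.elim (fun h => h.ne rfl) (fun ⟨_, h⟩ => h.ne rfl)⟩

theorem tot_adj {L : LinkGraph V} {a b : V} :
    L.tot.Adj a b ↔ L.edge.Adj a b ∨ ∃ i, (L.link i).Adj a b := Iff.rfl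

/-- The graph with the middle vertices of all paths made explicit. -/
def expand (L : LinkGraph V) : SimpleGraph (V ⊕ Sym2 V × Bool) where
  Adj p q := match p, q with
    | .inl a, .inl b => L.edge.Adj a b
    | .inl a, .inr (e, i) => a ∈ e ∧ e ∈ (L.link i).edgeSet
    | .inr (e, i), .inl a => a ∈ e ∧ e ∈ (L.link i).edgeSet
    | .inr _, .inr _ => False
  symm := ⟨by
    rintro (a | ⟨e, i⟩) (b | ⟨e', i'⟩) h
    · exact SimpleGraph.Adj.symm h
    · exact h
    · exact h
    · exact h⟩
  loopless := ⟨by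
    rintro (a | ⟨e, i⟩) h
    · exact SimpleGraph.irrefl _ h
    · exact h⟩

theorem expand_link {L : LinkGraph V} {a b : V} {i : Bool} (h : (L.link i).Adj a b) :
    L.expand.Adj (.inl a) (.inr (s(a, b), i)) := ⟨by simp, h⟩

/-- Deleting the vertices in `I`. -/
def cut (L : LinkGraph V) (I : Set V) : LinkGraph V where
  edge :=
    { Adj := fun a b => L.edge.Adj a b ∧ a ∉ I ∧ b ∉ I
      symm := ⟨fun _ _ h => ⟨h.1.symm, h.2.2, h.2.1⟩⟩
      loopless := ⟨fun _ h => h.1.ne rfl⟩ }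
  link i :=
    { Adj := fun a b => (L.link i).Adj a b ∧ a ∉ I ∧ b ∉ I
      symm := ⟨fun _ _ h => ⟨h.1.symm, h.2.2, h.2.1⟩⟩
      loopless := ⟨fun _ h => h.1.ne rfl⟩ }

/-- Joining `x` and `y` by a path. -/
def addLink (L : LinkGraph V) (i : Bool) (x y : V) : LinkGraph V where
  edge := L.edge
  link j :=
    { Adj := fun a b => (L.link j).Adj a b ∨ (j = i ∧ a ≠ b ∧ s(a, b) = s(x, y))
      symm := ⟨fun a b h => h.imp (fun h => h.symm)
        (fun h => ⟨h.1, h.2.1.symm, by rw [Sym2.eq_swap]; exact h.2.2⟩)⟩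
      loopless := ⟨fun _ h => h.elim (fun h => h.ne rfl) (fun h => h.2.1 rfl)⟩ }

theorem cut_edge_adj {L : LinkGraph V} {I : Set V} {a b : V} :
    (L.cut I).edge.Adj a b ↔ L.edge.Adj a b ∧ a ∉ I ∧ b ∉ I := Iff.rfl

theorem cut_link_adj {L : LinkGraph V} {I : Set V} {i : Bool} {a b : V} :
    ((L.cut I).link i).Adj a b ↔ (L.link i).Adj a b ∧ a ∉ I ∧ b ∉ I := Iff.rfl

theorem addLink_edge {L : LinkGraph V} {i : Bool} {x y : V} :
    (L.addLink i x y).edge = L.edge := rfl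

theorem addLink_link_adj {L : LinkGraph V} {i j : Bool} {x y a b : V} :
    ((L.addLink i x y).link j).Adj a b ↔
      (L.link j).Adj a b ∨ (j = i ∧ a ≠ b ∧ s(a, b) = s(x, y)) := Iff.rfl

theorem weakInducedMinor_of {W : Type} {L : LinkGraph V} {K : SimpleGraph W}
    (f : V ⊕ Sym2 V × Bool → Option W)
    (hconn : ∀ w, (L.expand.induce {v | f v = some w}).Preconnected)
    (hedge : ∀ a b p q, L.edge.Adj a b → f (.inl a) = some p → f (.inl b) = some q →
      p = q ∨ K.Adj p q)
    (hlink : ∀ a b i p q, (L.link i).Adj a b → f (.inl a) = some p →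
      f (.inr (s(a, b), i)) = some q → p = q ∨ K.Adj p q)
    (hK : ∀ a b, K.Adj a b → ∃ u v, f u = some a ∧ f v = some b ∧ L.expand.Adj u v) :
    IsWeakInducedMinor K L.expand := by
  have hlink' : ∀ a e i p q, a ∈ e → e ∈ (L.link i).edgeSet → f (.inl a) = some p →
      f (.inr (e, i)) = some q → p = q ∨ K.Adj p q := by
    rintro a e i p q ha he hp hq
    obtain ⟨b, rfl⟩ := ha
    exact hlink a b i p q he hp hq
  refine ⟨f, hconn, ?_, hK⟩
  rintro (u | ⟨e, i⟩) (v | ⟨e', i'⟩) a b huv hu hv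
  · exact hedge u v a b huv hu hv
  · exact hlink' u e' i' a b huv.1 huv.2 hu hv
  · exact (hlink' v e i b a huv.1 huv.2 hv hu).imp Eq.symm SimpleGraph.Adj.symm
  · exact huv.elim

theorem expand_weakInducedMinor_of {L L' : LinkGraph V}
    (f : V ⊕ Sym2 V × Bool → Option (V ⊕ Sym2 V × Bool))
    (hconn : ∀ w, (L.expand.induce {v | f v = some w}).Preconnected)
    (hedge : ∀ a b p q, L.edge.Adj a b → f (.inl a) = some p → f (.inl b) = some q →
      p = q ∨ L'.expand.Adj p q)
    (hlink : ∀ a b i p q, (L.link i).Adj a b → f (.inl a) = some p →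
      f (.inr (s(a, b), i)) = some q → p = q ∨ L'.expand.Adj p q)
    (hedge' : ∀ a b, L'.edge.Adj a b →
      ∃ u v, f u = some (.inl a) ∧ f v = some (.inl b) ∧ L.expand.Adj u v)
    (hlink' : ∀ a b i, (L'.link i).Adj a b →
      ∃ u v, f u = some (.inl a) ∧ f v = some (.inr (s(a, b), i)) ∧ L.expand.Adj u v) :
    IsWeakInducedMinor L'.expand L.expand := by
  have key : ∀ a e i, a ∈ e → e ∈ (L'.link i).edgeSet →
      ∃ u v, f u = some (.inl a) ∧ f v = some (.inr (e, i)) ∧ L.expand.Adj u v := by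
    rintro a e i ⟨b, rfl⟩ he
    exact hlink' a b i he
  refine weakInducedMinor_of f hconn hedge hlink ?_
  rintro (u | ⟨e, i⟩) (v | ⟨e', i'⟩) huv
  · exact hedge' u v huv
  · exact key u e' i' huv.1 huv.2
  · obtain ⟨p, q, hp, hq, hpq⟩ := key v e i huv.1 huv.2
    exact ⟨q, p, hq, hp, hpq.symm⟩
  · exact huv.elim

theorem preconnected_of_subsingleton {U : Type} {G : SimpleGraph U} {S : Set U}
    (h : S.Subsingleton) : (G.induce S).Preconnected := by
  rintro ⟨a, ha⟩ ⟨b, hb⟩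
  obtain rfl := h ha hb
  exact .rfl

theorem expand_bot (G : SimpleGraph V) :
    IsWeakInducedMinor (expand ⟨G, fun _ => ⊥⟩) G := by
  refine ⟨fun v => some (.inl v), fun w => preconnected_of_subsingleton ?_, ?_, ?_⟩
  · intro a ha b hb
    exact Sum.inl.inj (Option.some.inj (ha.trans hb.symm))
  · rintro u v a b huv ⟨⟩ ⟨⟩
    exact .inr huv
  · rintro (a | ⟨e, i⟩) (b | ⟨e', i'⟩) h
    · exact ⟨a, b, rfl, rfl, h⟩
    · simpa using h.2
    · simpa using h.2
    · exact h.elim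

theorem expand_cut (L : LinkGraph V) (I : Set V) :
    IsWeakInducedMinor (L.cut I).expand L.expand := by
  classical
  refine expand_weakInducedMinor_of (fun p => match p with
    | .inl a => if a ∈ I then none else some (.inl a)
    | .inr (e, i) => if e ∈ ((L.cut I).link i).edgeSet then some (.inr (e, i)) else none)
    ?_ ?_ ?_ ?_ ?_
  · intro w
    refine preconnected_of_subsingleton ?_
    rintro (a | ⟨e, i⟩) ha (b | ⟨e', i'⟩) hb <;> simp only [Set.mem_ofPred_eq] at ha hb <;>
      split_ifs at ha hb <;> grind
  · intro a b p q h hp hq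
    simp only at hp hq
    split_ifs at hp hq with h1 h2
    cases hp; cases hq
    exact .inr ⟨h, h1, h2⟩
  · intro a b i p q h hp hq
    simp only at hp hq
    split_ifs at hp hq with h1 h2
    cases hp; cases hq
    exact .inr (expand_link h2)
  · intro a b h
    exact ⟨.inl a, .inl b, by simp [h.2.1], by simp [h.2.2], h.1⟩
  · intro a b i h
    exact ⟨.inl a, .inr (s(a, b), i), by simp [h.2.1], by simp [h], expand_link h.1⟩

/-- A connected set `I` whose only outside neighbours are `x` and `y` can be contracted to the
middle vertex of a path from `x` to `y`. -/
theorem expand_cut_addLink (L : LinkGraph V) {I : Set V} {x y p : V} {i : Bool}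
    (hne : x ≠ y) (hx : x ∉ I) (hy : y ∉ I) (hxy : ¬ (L.link i).Adj x y)
    (hconn : ∀ w ∈ I, Relation.ReflTransGen (StepIn L.tot I) w p)
    (hnb : ∀ a b, L.tot.Adj a b → a ∈ I → b ∉ I → b = x ∨ b = y)
    (hpx : ∃ w ∈ I, L.tot.Adj x w) (hpy : ∃ w ∈ I, L.tot.Adj y w) :
    IsWeakInducedMinor ((L.cut I).addLink i x y).expand L.expand := by
  classical
  have hmid : ∀ a b j, (L.link j).Adj a b → ((∃ w ∈ I, w ∈ s(a, b)) ↔ a ∈ I ∨ b ∈ I) := by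
    intro a b j h
    simp only [Sym2.mem_iff]
    grind
  set f : V ⊕ Sym2 V × Bool → Option (V ⊕ Sym2 V × Bool) := fun p => match p with
    | .inl a => if a ∈ I then some (.inr (s(x, y), i)) else some (.inl a)
    | .inr (e, j) => if e ∈ (L.link j).edgeSet then
        (if ∃ w ∈ I, w ∈ e then some (.inr (s(x, y), i)) else some (.inr (e, j))) else none
    with hf
  have f1 : ∀ a ∈ I, f (.inl a) = some (.inr (s(x, y), i)) := by
    intro a ha; simp [hf, ha]
  have f2 : ∀ a ∉ I, f (.inl a) = some (.inl a) := by
    intro a ha; simp [hf, ha]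
  have f3 : ∀ a b j, (L.link j).Adj a b → a ∈ I ∨ b ∈ I →
      f (.inr (s(a, b), j)) = some (.inr (s(x, y), i)) := by
    intro a b j h h'
    have := (hmid a b j h).2 h'
    simp only [hf, SimpleGraph.mem_edgeSet, h, this, if_true]
  have f4 : ∀ a b j, (L.link j).Adj a b → a ∉ I → b ∉ I →
      f (.inr (s(a, b), j)) = some (.inr (s(a, b), j)) := by
    intro a b j h h1 h2
    have : ¬ ∃ w ∈ I, w ∈ s(a, b) := fun h3 => by
      have := (hmid a b j h).1 h3; tauto
    simp only [hf, SimpleGraph.mem_edgeSet, h, this, if_true, if_false]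
  have f5 : ∀ a b j, ¬ (L.link j).Adj a b → f (.inr (s(a, b), j)) = none := by
    intro a b j h
    simp only [hf, SimpleGraph.mem_edgeSet, h, if_false]
  clear_value f
  have step : ∀ a b, StepIn L.tot I a b →
      Relation.ReflTransGen (StepIn L.expand {v | f v = some (.inr (s(x, y), i))})
        (.inl a) (.inl b) := by
    rintro a b ⟨h | ⟨j, h⟩, ha, hb⟩
    · exact .single ⟨h, f1 a ha, f1 b hb⟩
    · refine .head (b := .inr (s(a, b), j)) ⟨expand_link h, f1 a ha, f3 a b j h (.inl ha)⟩
        (.single ⟨?_, f3 a b j h (.inl ha), f1 b hb⟩)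
      rw [Sym2.eq_swap]
      exact (expand_link h.symm).symm
  refine expand_weakInducedMinor_of f ?_ ?_ ?_ ?_ ?_
  · intro w
    by_cases hw : w = .inr (s(x, y), i)
    · subst hw
      have main : ∀ a ∈ I, Relation.ReflTransGen
          (StepIn L.expand {v | f v = some (.inr (s(x, y), i))}) (.inl a) (.inl p) := by
        intro a ha
        have := hconn a ha
        induction this using Relation.ReflTransGen.head_induction_on with
        | refl => exact .refl
        | head h _ ih => exact (step _ _ h).trans (ih h.2.2)
      refine preconnected_of_center (.inl p) ?_
      rintro (a | ⟨e, j⟩) ha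
      · by_cases haI : a ∈ I
        · exact main a haI
        · exact absurd ((f2 a haI).symm.trans ha) (by simp)
      · induction e with | _ a b =>
        by_cases h : (L.link j).Adj a b
        · by_cases h1 : a ∈ I
          · exact .head ⟨(expand_link h).symm, ha, f1 a h1⟩ (main a h1)
          · by_cases h2 : b ∈ I
            · refine .head ⟨?_, ha, f1 b h2⟩ (main b h2)
              rw [Sym2.eq_swap]
              exact (expand_link h.symm).symm
            · have h3 := (f4 a b j h h1 h2).symm.trans ha
              simp only [Option.some.injEq, Sum.inr.injEq, Prod.mk.injEq] at h3
              obtain ⟨h3, rfl⟩ := h3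
              refine absurd ?_ hxy
              rwa [← SimpleGraph.mem_edgeSet, ← h3]
        · exact absurd ((f5 a b j h).symm.trans ha) (by simp)
    · refine preconnected_of_subsingleton ?_
      have key : ∀ q, f q = some w → q = w := by
        rintro (a | ⟨e, j⟩) ha
        · by_cases haI : a ∈ I
          · have := f1 a haI; grind
          · have := f2 a haI; grind
        · induction e with | _ a b =>
          by_cases h : (L.link j).Adj a b
          · by_cases h1 : a ∈ I ∨ b ∈ I
            · have := f3 a b j h h1; grind
            · push Not at h1
              have := f4 a b j h h1.1 h1.2; grind
          · have := f5 a b j h; grind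
      intro a ha b hb
      rw [key a ha, key b hb]
  · intro a b p q h hp hq
    by_cases ha : a ∈ I <;> by_cases hb : b ∈ I
    · rw [f1 a ha] at hp; rw [f1 b hb] at hq; grind
    · rw [f1 a ha] at hp; rw [f2 b hb] at hq
      cases hp; cases hq
      exact .inr ⟨by simpa using hnb a b (.inl h) ha hb, .inr ⟨rfl, hne, rfl⟩⟩
    · rw [f2 a ha] at hp; rw [f1 b hb] at hq
      cases hp; cases hq
      exact .inr ⟨by simpa using hnb b a (.inl h.symm) hb ha, .inr ⟨rfl, hne, rfl⟩⟩
    · rw [f2 a ha] at hp; rw [f2 b hb] at hq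
      cases hp; cases hq
      exact .inr ⟨h, ha, hb⟩
  · intro a b j p q h hp hq
    by_cases hI : a ∈ I ∨ b ∈ I
    · rw [f3 a b j h hI] at hq
      by_cases ha : a ∈ I
      · rw [f1 a ha] at hp; grind
      · rw [f2 a ha] at hp
        cases hp; cases hq
        exact .inr ⟨by simpa using hnb b a (.inr ⟨j, h.symm⟩) (hI.resolve_left ha) ha,
          .inr ⟨rfl, hne, rfl⟩⟩
    · push Not at hI
      rw [f4 a b j h hI.1 hI.2] at hq
      rw [f2 a hI.1] at hp
      cases hp; cases hq
      exact .inr (expand_link (.inl ⟨h, hI.1, hI.2⟩))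
  · intro a b h
    exact ⟨.inl a, .inl b, f2 a h.2.1, f2 b h.2.2, h.1⟩
  · have key : ∀ z, z ∉ I → (∃ w ∈ I, L.tot.Adj z w) → 
        ∃ u v, f u = some (.inl z) ∧ f v = some (.inr (s(x, y), i)) ∧ L.expand.Adj u v := by
      rintro z hz ⟨w, hw, h | ⟨j, h⟩⟩
      · exact ⟨.inl z, .inl w, f2 z hz, f1 w hw, h⟩
      · exact ⟨.inl z, .inr (s(z, w), j), f2 z hz, f3 z w j h (.inr hw), expand_link h⟩
    rintro a b j (h | ⟨rfl, hab, h⟩)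
    · exact ⟨.inl a, .inr (s(a, b), j), f2 a h.2.1, f4 a b j h.1 h.2.1 h.2.2, expand_link h.1⟩
    · rw [h]
      rcases Sym2.eq_iff.1 h with ⟨rfl, rfl⟩ | ⟨rfl, rfl⟩
      · exact key a hx hpx
      · exact key a hy hpy

theorem addLink_comm (L : LinkGraph V) (i : Bool) (x y : V) :
    L.addLink i x y = L.addLink i y x := by
  simp only [addLink, Sym2.eq_swap (a := x)]

/-- Deleting `u` and joining `x` and `y` by two paths. -/
def bypass (L : LinkGraph V) (u x y : V) : LinkGraph V :=
  ((L.cut {u}).addLink false x y).addLink true x y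

theorem bypass_comm (L : LinkGraph V) (u x y : V) : L.bypass u x y = L.bypass u y x := by
  simp only [bypass, addLink_comm _ _ x y]

theorem bypass_edge_adj {L : LinkGraph V} {u x y a b : V} :
    (L.bypass u x y).edge.Adj a b ↔ L.edge.Adj a b ∧ a ≠ u ∧ b ≠ u := by
  simp [bypass, addLink_edge, cut_edge_adj]

theorem bypass_link_adj {L : LinkGraph V} {u x y a b : V} {i : Bool} :
    ((L.bypass u x y).link i).Adj a b ↔ ((L.link i).Adj a b ∧ a ≠ u ∧ b ≠ u) ∨
      (a ≠ b ∧ s(a, b) = s(x, y)) := by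
  cases i <;> simp [bypass, addLink_link_adj, cut_link_adj]

/-- The vertex `u` of degree two is contracted into its neighbour `x`. -/
theorem expand_bypass (L : LinkGraph V) {u x y : V} (hxy : x ≠ y)
    (hN : ∀ a, L.tot.Adj u a → a = x ∨ a = y) (hux : L.tot.Adj u x)
    (huy : ∀ i, (L.link i).Adj u y) (hey : ¬ L.edge.Adj u y) (hn : ¬ L.tot.Adj x y) :
    IsWeakInducedMinor (L.bypass u x y).expand L.expand := by
  classical
  have hedge' := fun a b => bypass_edge_adj (L := L) (u := u) (x := x) (y := y) (a := a) (b := b)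
  have hlink' := fun a b i =>
    bypass_link_adj (L := L) (u := u) (x := x) (y := y) (a := a) (b := b) (i := i)
  generalize L.bypass u x y = L' at hedge' hlink' ⊢
  have hxu : x ≠ u := hux.ne'
  have hyu : y ≠ u := (huy true).ne'
  have hNe : ∀ a, L.edge.Adj u a → a = x := fun a h =>
    (hN a (.inl h)).resolve_right (fun h' => hey (h' ▸ h))
  have hNl : ∀ a i, (L.link i).Adj u a → a = x ∨ a = y := fun a i h => hN a (.inr ⟨i, h⟩)
  have hnl : ∀ i, ¬ (L.link i).Adj x y := fun i h => hn (.inr ⟨i, h⟩)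
  set f : V ⊕ Sym2 V × Bool → Option (V ⊕ Sym2 V × Bool) := fun p => match p with
    | .inl a => if a = u then some (.inl x) else some (.inl a)
    | .inr (e, j) => if e ∈ (L.link j).edgeSet then
        (if e = s(u, x) then some (.inl x) else if e = s(u, y) then some (.inr (s(x, y), j))
          else some (.inr (e, j))) else none
    with hf
  have f1 : f (.inl u) = some (.inl x) := by simp [hf]
  have f2 : ∀ a ≠ u, f (.inl a) = some (.inl a) := by intro a ha; simp [hf, ha]
  have f3 : ∀ j, (L.link j).Adj u x → f (.inr (s(u, x), j)) = some (.inl x) := by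
    intro j h
    simp [hf, h]
  have hne : s(u, y) ≠ s(u, x) := by simp; grind
  have f4 : ∀ j, f (.inr (s(u, y), j)) = some (.inr (s(x, y), j)) := by
    intro j
    simp only [hf, SimpleGraph.mem_edgeSet, huy, if_true, if_neg hne]
  have f5 : ∀ a b j, (L.link j).Adj a b → a ≠ u → b ≠ u →
      f (.inr (s(a, b), j)) = some (.inr (s(a, b), j)) := by
    intro a b j h h1 h2
    have e1 : s(a, b) ≠ s(u, x) := by simp; grind
    have e2 : s(a, b) ≠ s(u, y) := by simp; grind
    simp only [hf, SimpleGraph.mem_edgeSet, h, if_true, if_neg e1, if_neg e2]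
  have f6 : ∀ a b j, ¬ (L.link j).Adj a b → f (.inr (s(a, b), j)) = none := by
    intro a b j h
    simp only [hf, SimpleGraph.mem_edgeSet, h, if_false]
  clear_value f
  have hmid : ∀ a b j, (L.link j).Adj a b →
      (a ≠ u ∧ b ≠ u) ∨ (s(a, b) = s(u, x) ∧ (L.link j).Adj u x) ∨ s(a, b) = s(u, y) := by
    intro a b j h
    by_cases ha : a = u
    · subst ha
      rcases hNl b j h with rfl | rfl <;> simp [h]
    · by_cases hb : b = u
      · subst hb
        rcases hNl a j h.symm with rfl | rfl <;> simp [h.symm]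
      · exact .inl ⟨ha, hb⟩
  have hlx : ∀ j, s(u, x) ∈ (L.link j).edgeSet ↔ (L.link j).Adj u x := fun j => Iff.rfl
  refine expand_weakInducedMinor_of f ?_ ?_ ?_ ?_ ?_
  · intro w
    by_cases hw : w = .inl x
    · subst hw
      refine preconnected_of_center (.inl u) ?_
      rintro (a | ⟨e, j⟩) ha
      · by_cases hau : a = u
        · rw [hau]
        · have := (f2 a hau).symm.trans ha
          simp only [Option.some.injEq, Sum.inl.injEq] at this
          subst this
          rcases hux.symm with h | ⟨i, h⟩
          · exact .single ⟨h, ha, f1⟩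
          · refine .head (b := .inr (s(u, a), i)) ⟨?_, ha, f3 i h.symm⟩
              (.single ⟨(expand_link h.symm).symm, f3 i h.symm, f1⟩)
            rw [Sym2.eq_swap]
            exact expand_link h
      · induction e with | _ a b =>
        by_cases h : (L.link j).Adj a b
        · rcases hmid a b j h with ⟨h1, h2⟩ | ⟨h1, h2⟩ | h1
          · exact absurd ((f5 a b j h h1 h2).symm.trans ha) (by simp)
          · rw [h1] at ha ⊢
            exact .single ⟨(expand_link h2).symm, ha, f1⟩
          · rw [h1] at ha
            exact absurd ((f4 j).symm.trans ha) (by simp)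
        · exact absurd ((f6 a b j h).symm.trans ha) (by simp)
    · refine preconnected_of_subsingleton ?_
      have key : ∀ q, f q = some w → (∃ j, q = .inr (s(u, y), j) ∧ w = .inr (s(x, y), j)) ∨
          (q = w ∧ ∀ j, w ≠ .inr (s(x, y), j)) := by
        rintro (a | ⟨e, j⟩) ha
        · by_cases hau : a = u
          · grind
          · have := f2 a hau
            grind
        · induction e with | _ a b =>
          by_cases h : (L.link j).Adj a b
          · rcases hmid a b j h with ⟨h1, h2⟩ | ⟨h1, h2⟩ | h1
            · have h3 := Option.some.inj ((f5 a b j h h1 h2).symm.trans ha)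
              subst h3
              refine .inr ⟨rfl, ?_⟩
              intro i hi
              simp only [Sum.inr.injEq, Prod.mk.injEq] at hi
              apply hnl j
              rw [← SimpleGraph.mem_edgeSet, ← hi.1]
              exact h
            · rw [h1, f3 j h2] at ha
              exact absurd (Option.some.inj ha).symm hw
            · rw [h1, f4 j] at ha
              exact .inl ⟨j, by rw [h1], (Option.some.inj ha).symm⟩
          · have := f6 a b j h; grind
      intro a ha b hb
      rcases key a ha with ⟨j, h1, h2⟩ | ⟨h1, h2⟩ <;> rcases key b hb with ⟨i, h3, h4⟩ | ⟨h3, h4⟩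
      · have := h2.symm.trans h4
        simp only [Sum.inr.injEq, Prod.mk.injEq, true_and] at this
        rw [h1, h3, this]
      · exact absurd h2 (h4 j)
      · exact absurd h4 (h2 i)
      · rw [h1, h3]
  · intro a b p q h hp hq
    by_cases ha : a = u
    · subst ha
      rw [f1] at hp
      have := hNe b h
      subst this
      rw [f2 b hxu] at hq
      grind
    · by_cases hb : b = u
      · subst hb
        rw [f1] at hq
        have := hNe a h.symm
        subst this
        rw [f2 a hxu] at hp
        grind
      · rw [f2 a ha] at hp; rw [f2 b hb] at hq
        cases hp; cases hq
        exact .inr ((hedge' a b).2 ⟨h, ha, hb⟩)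
  · intro a b j p q h hp hq
    have hxyl : (L'.link j).Adj x y := (hlink' x y j).2 (.inr ⟨hxy, rfl⟩)
    rcases hmid a b j h with ⟨h1, h2⟩ | ⟨h1, h2⟩ | h1
    · rw [f5 a b j h h1 h2] at hq
      rw [f2 a h1] at hp
      cases hp; cases hq
      exact .inr (expand_link ((hlink' a b j).2 (.inl ⟨h, h1, h2⟩)))
    · rw [h1, f3 j h2] at hq
      rcases Sym2.eq_iff.1 h1 with ⟨rfl, rfl⟩ | ⟨rfl, rfl⟩
      · grind
      · rw [f2 _ hxu] at hp; grind
    · rw [h1, f4 j] at hq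
      cases hq
      rcases Sym2.eq_iff.1 h1 with ⟨rfl, rfl⟩ | ⟨rfl, rfl⟩
      · rw [f1] at hp
        cases hp
        exact .inr (expand_link hxyl)
      · rw [f2 _ hyu] at hp
        cases hp
        refine .inr ?_
        rw [Sym2.eq_swap]
        exact expand_link hxyl.symm
  · intro a b h
    obtain ⟨h, ha, hb⟩ := (hedge' a b).1 h
    exact ⟨.inl a, .inl b, f2 a ha, f2 b hb, h⟩
  · intro a b j h
    rcases (hlink' a b j).1 h with ⟨h, ha, hb⟩ | ⟨_, h⟩
    · exact ⟨.inl a, .inr (s(a, b), j), f2 a ha, f5 a b j h ha hb, expand_link h⟩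
    · rw [h]
      rcases Sym2.eq_iff.1 h with ⟨rfl, rfl⟩ | ⟨rfl, rfl⟩
      · exact ⟨.inl u, .inr (s(u, b), j), f1, f4 j, expand_link (huy j)⟩
      · refine ⟨.inl a, .inr (s(u, a), j), f2 _ hyu, f4 j, ?_⟩
        rw [Sym2.eq_swap]
        exact expand_link (huy j).symm

end LinkGraph

theorem graphX_cases {P : Fin 9 → Fin 9 → Prop} (hs : ∀ a b, P a b → P b a)
    (h : P 0 1 ∧ P 2 1 ∧ P 2 3 ∧ P 4 3 ∧ P 4 5 ∧ P 0 5 ∧ P 0 6 ∧ P 2 6 ∧ P 2 7 ∧ P 4 7 ∧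
      P 4 8 ∧ P 0 8) {a b : Fin 9} (hab : graphX.Adj a b) : P a b := by
  simp only [graphX, SimpleGraph.fromEdgeSet_adj, Set.mem_insert_iff, Set.mem_singleton_iff,
    Sym2.eq_iff] at hab
  obtain ⟨h1, h2, h3, h4, h5, h6, h7, h8, h9, h10, h11, h12⟩ := h
  rcases hab.1 with (⟨rfl, rfl⟩ | ⟨rfl, rfl⟩) | (⟨rfl, rfl⟩ | ⟨rfl, rfl⟩) |
    (⟨rfl, rfl⟩ | ⟨rfl, rfl⟩) | (⟨rfl, rfl⟩ | ⟨rfl, rfl⟩) | (⟨rfl, rfl⟩ | ⟨rfl, rfl⟩) |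
    (⟨rfl, rfl⟩ | ⟨rfl, rfl⟩) | (⟨rfl, rfl⟩ | ⟨rfl, rfl⟩) | (⟨rfl, rfl⟩ | ⟨rfl, rfl⟩) |
    (⟨rfl, rfl⟩ | ⟨rfl, rfl⟩) | (⟨rfl, rfl⟩ | ⟨rfl, rfl⟩) | (⟨rfl, rfl⟩ | ⟨rfl, rfl⟩) |
    (⟨rfl, rfl⟩ | ⟨rfl, rfl⟩) <;> first | assumption | (apply hs; assumption)

theorem graphX_adj {a b : Fin 9}
    (h : (a, b) ∈ [((0 : Fin 9), (1 : Fin 9)), (2, 1), (2, 3), (4, 3), (4, 5), (0, 5), (0, 6),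
      (2, 6), (2, 7), (4, 7), (4, 8), (0, 8)]) : graphX.Adj a b := by
  simp only [graphX, SimpleGraph.fromEdgeSet_adj, Set.mem_insert_iff, Set.mem_singleton_iff,
    Sym2.eq_iff]
  simp only [List.mem_cons, Prod.mk.injEq, List.not_mem_nil, or_false] at h
  rcases h with ⟨rfl, rfl⟩ | ⟨rfl, rfl⟩ | ⟨rfl, rfl⟩ | ⟨rfl, rfl⟩ | ⟨rfl, rfl⟩ | ⟨rfl, rfl⟩ |
    ⟨rfl, rfl⟩ | ⟨rfl, rfl⟩ | ⟨rfl, rfl⟩ | ⟨rfl, rfl⟩ | ⟨rfl, rfl⟩ | ⟨rfl, rfl⟩ <;> simp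

theorem exists_graphX_adj (a : Fin 9) : ∃ b, graphX.Adj a b := by
  fin_cases a
  · exact ⟨1, graphX_adj (by simp)⟩
  · exact ⟨0, (graphX_adj (by simp)).symm⟩
  · exact ⟨1, graphX_adj (by simp)⟩
  · exact ⟨2, (graphX_adj (by simp)).symm⟩
  · exact ⟨3, graphX_adj (by simp)⟩
  · exact ⟨4, (graphX_adj (by simp)).symm⟩
  · exact ⟨0, (graphX_adj (by simp)).symm⟩
  · exact ⟨2, (graphX_adj (by simp)).symm⟩
  · exact ⟨4, (graphX_adj (by simp)).symm⟩

namespace LinkGraph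

variable {V : Type}

theorem graphX_weakInducedMinor {L : LinkGraph V} {a b c d : V} (hab : a ≠ b)
    (hca : c ≠ a) (hcb : c ≠ b) (hda : d ≠ a) (hdb : d ≠ b)
    (lab : ∀ i, (L.link i).Adj a b) (lca : ∀ i, (L.link i).Adj c a)
    (lbd : ∀ i, (L.link i).Adj b d)
    (hcd : c = d ∨ L.tot.Adj c d)
    (he : ¬ L.edge.Adj a b ∧ ¬ L.edge.Adj a c ∧ ¬ L.edge.Adj a d ∧ ¬ L.edge.Adj b c ∧
      ¬ L.edge.Adj b d) :
    IsWeakInducedMinor graphX L.expand := by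
  classical
  set f : V ⊕ Sym2 V × Bool → Option (Fin 9) := fun p => match p with
    | .inl v => if v = a then some 0 else if v = b then some 2
        else if v = c ∨ v = d then some 4 else none
    | .inr (e, i) => if e ∈ (L.link i).edgeSet then
        (if e = s(a, b) then some (if i then 6 else 1) else
          if e = s(b, d) then some (if i then 7 else 3) else
          if e = s(c, a) then some (if i then 8 else 5) else
          if e = s(c, d) then some 4 else none) else none
    with hf
  have f0 : f (.inl a) = some 0 := by simp [hf]
  have f1 : f (.inl b) = some 2 := by simp [hf, hab.symm]
  have f2 : f (.inl c) = some 4 := by simp [hf, hca, hcb]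
  have f3 : f (.inl d) = some 4 := by simp [hf, hda, hdb]
  have fn : ∀ v, v ≠ a → v ≠ b → v ≠ c → v ≠ d → f (.inl v) = none := by
    intro v h1 h2 h3 h4; simp [hf, h1, h2, h3, h4]
  have e1 : s(b, d) ≠ s(a, b) := by simp; grind
  have e2 : s(c, a) ≠ s(a, b) := by simp; grind
  have e3 : s(c, a) ≠ s(b, d) := by simp; grind
  have e4 : s(c, d) ≠ s(a, b) := by simp; grind
  have e5 : s(c, d) ≠ s(b, d) := by simp; grind
  have e6 : s(c, d) ≠ s(c, a) := by simp; grind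
  have g1 : ∀ i, f (.inr (s(a, b), i)) = some (if i then 6 else 1) := by
    intro i; simp only [hf, SimpleGraph.mem_edgeSet, lab, if_true]
  have g2 : ∀ i, f (.inr (s(b, d), i)) = some (if i then 7 else 3) := by
    intro i; simp only [hf, SimpleGraph.mem_edgeSet, lbd, if_true, if_neg e1]
  have g3 : ∀ i, f (.inr (s(c, a), i)) = some (if i then 8 else 5) := by
    intro i; simp only [hf, SimpleGraph.mem_edgeSet, lca, if_true, if_neg e2, if_neg e3]
  have g4 : ∀ i, (L.link i).Adj c d → f (.inr (s(c, d), i)) = some 4 := by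
    intro i h
    simp only [hf, SimpleGraph.mem_edgeSet, h, if_true, if_neg e4, if_neg e5, if_neg e6]
  have gn : ∀ e i w, f (.inr (e, i)) = some w →
      e = s(a, b) ∨ e = s(b, d) ∨ e = s(c, a) ∨ (e = s(c, d) ∧ (L.link i).Adj c d) := by
    intro e i w h
    by_contra hcon
    push Not at hcon
    obtain ⟨h1, h2, h3, h4⟩ := hcon
    simp only [hf, if_neg h1, if_neg h2, if_neg h3] at h
    split_ifs at h with h0 h5
    subst h5
    exact h4 rfl h0
  clear_value f
  have vn : ∀ v w, f (.inl v) = some w → v = a ∨ v = b ∨ v = c ∨ v = d := by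
    intro v w h
    by_contra! hcon
    have := fn v hcon.1 hcon.2.1 hcon.2.2.1 hcon.2.2.2
    simp_all
  refine weakInducedMinor_of f ?_ ?_ ?_ ?_
  · intro w
    by_cases hw : w = 4
    · subst hw
      have hdc : Relation.ReflTransGen (StepIn L.expand {v | f v = some 4}) (.inl d) (.inl c) := by
        rcases hcd with rfl | h | ⟨i, h⟩
        · exact .refl
        · exact .single ⟨h.symm, f3, f2⟩
        · refine .head (b := .inr (s(c, d), i)) ⟨?_, f3, g4 i h⟩
            (.single ⟨(expand_link h).symm, g4 i h, f2⟩)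
          rw [Sym2.eq_swap]
          exact expand_link h.symm
      refine preconnected_of_center (.inl c) ?_
      rintro (v | ⟨e, i⟩) hv
      · rcases vn v _ hv with rfl | rfl | rfl | rfl
        · exact absurd (f0.symm.trans hv) (by decide)
        · exact absurd (f1.symm.trans hv) (by decide)
        · exact .refl
        · exact hdc
      · rcases gn e i _ hv with rfl | rfl | rfl | ⟨rfl, h⟩
        · exact absurd ((g1 i).symm.trans hv) (by cases i <;> decide)
        · exact absurd ((g2 i).symm.trans hv) (by cases i <;> decide)
        · exact absurd ((g3 i).symm.trans hv) (by cases i <;> decide)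
        · exact .single ⟨(expand_link h).symm, hv, f2⟩
    · refine preconnected_of_subsingleton ?_
      have key : ∀ q, f q = some w → q = (![.inl a, .inr (s(a, b), false), .inl b,
          .inr (s(b, d), false), .inl c, .inr (s(c, a), false), .inr (s(a, b), true),
          .inr (s(b, d), true), .inr (s(c, a), true)] : Fin 9 → V ⊕ Sym2 V × Bool) w := by
        rintro (v | ⟨e, i⟩) hv
        · rcases vn v _ hv with rfl | rfl | rfl | rfl
          · rw [f0] at hv; cases hv; rfl
          · rw [f1] at hv; cases hv; rfl
          · rw [f2] at hv; exact absurd (Option.some.inj hv).symm hw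
          · rw [f3] at hv; exact absurd (Option.some.inj hv).symm hw
        · rcases gn e i _ hv with rfl | rfl | rfl | ⟨rfl, h⟩
          · rw [g1] at hv; cases i <;> cases hv <;> rfl
          · rw [g2] at hv; cases i <;> cases hv <;> rfl
          · rw [g3] at hv; cases i <;> cases hv <;> rfl
          · rw [g4 i h] at hv; exact absurd (Option.some.inj hv).symm hw
      intro p hp q hq
      rw [key p hp, key q hq]
  · intro v w p q h hp hq
    have hl : ∀ v, ¬ L.edge.Adj v v := fun v => L.edge.irrefl
    have hs : ∀ v w, L.edge.Adj v w → L.edge.Adj w v := fun _ _ h => h.symm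
    rcases vn v _ hp with rfl | rfl | rfl | rfl <;> rcases vn w _ hq with rfl | rfl | rfl | rfl <;>
      grind
  · intro v w i p q h hp hq
    rcases gn _ i _ hq with h1 | h1 | h1 | ⟨h1, h2⟩
    · rw [h1, g1] at hq
      cases hq
      rcases Sym2.eq_iff.1 h1 with ⟨rfl, rfl⟩ | ⟨rfl, rfl⟩
      · rw [f0] at hp; cases hp
        cases i <;> exact .inr (graphX_adj (by simp))
      · rw [f1] at hp; cases hp
        cases i <;> exact .inr (graphX_adj (by simp))
    · rw [h1, g2] at hq
      cases hq
      rcases Sym2.eq_iff.1 h1 with ⟨rfl, rfl⟩ | ⟨rfl, rfl⟩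
      · rw [f1] at hp; cases hp
        cases i <;> exact .inr (graphX_adj (by simp))
      · rw [f3] at hp; cases hp
        cases i <;> exact .inr (graphX_adj (by simp))
    · rw [h1, g3] at hq
      cases hq
      rcases Sym2.eq_iff.1 h1 with ⟨rfl, rfl⟩ | ⟨rfl, rfl⟩
      · rw [f2] at hp; cases hp
        cases i <;> exact .inr (graphX_adj (by simp))
      · rw [f0] at hp; cases hp
        cases i <;> exact .inr (graphX_adj (by simp))
    · rw [h1, g4 i h2] at hq
      rcases Sym2.eq_iff.1 h1 with ⟨rfl, rfl⟩ | ⟨rfl, rfl⟩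
      · left; grind
      · left; grind
  · have hr : ∀ {v w : V} {i : Bool}, (L.link i).Adj v w →
        L.expand.Adj (.inl w) (.inr (s(v, w), i)) := by
      intro v w i h
      rw [Sym2.eq_swap]
      exact expand_link h.symm
    intro p q h
    refine graphX_cases (P := fun p q => ∃ u v, f u = some p ∧ f v = some q ∧ L.expand.Adj u v)
      ?_ ⟨?_, ?_, ?_, ?_, ?_, ?_, ?_, ?_, ?_, ?_, ?_, ?_⟩ h
    · rintro p q ⟨u, v, hu, hv, h⟩
      exact ⟨v, u, hv, hu, h.symm⟩
    · exact ⟨_, _, f0, g1 false, expand_link (lab _)⟩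
    · exact ⟨_, _, f1, g1 false, hr (lab _)⟩
    · exact ⟨_, _, f1, g2 false, expand_link (lbd _)⟩
    · exact ⟨_, _, f3, g2 false, hr (lbd _)⟩
    · exact ⟨_, _, f2, g3 false, expand_link (lca _)⟩
    · exact ⟨_, _, f0, g3 false, hr (lca _)⟩
    · exact ⟨_, _, f0, g1 true, expand_link (lab _)⟩
    · exact ⟨_, _, f1, g1 true, hr (lab _)⟩
    · exact ⟨_, _, f1, g2 true, expand_link (lbd _)⟩
    · exact ⟨_, _, f3, g2 true, hr (lbd _)⟩
    · exact ⟨_, _, f2, g3 true, expand_link (lca _)⟩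
    · exact ⟨_, _, f0, g3 true, hr (lca _)⟩

theorem exists_inner_chain_of_walk {K : SimpleGraph V} {x y a : V} (p : K.Walk a y)
    (hx : x ∉ p.support) (hay : a ≠ y) : ∃ q, K.Adj q y ∧ q ≠ x ∧ q ≠ y ∧
      Relation.ReflTransGen (StepIn K {v | v ≠ x ∧ v ≠ y}) q a := by
  induction p with
  | nil => exact absurd rfl hay
  | @cons a b y h p ih =>
    simp only [SimpleGraph.Walk.support_cons, List.mem_cons, not_or] at hx
    by_cases hby : b = y
    · subst hby
      exact ⟨a, h, Ne.symm hx.1, hay, .refl⟩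
    · obtain ⟨q, hq, hqx, hqy, hr⟩ := ih hx.2 hby
      refine ⟨q, hq, hqx, hqy, hr.tail ⟨h.symm, ⟨?_, hby⟩, ⟨Ne.symm hx.1, hay⟩⟩⟩
      rintro rfl
      exact hx.2 p.start_mem_support

theorem exists_inner_chain {K : SimpleGraph V} {x y : V} (h : K.Reachable x y) (hne : x ≠ y)
    (hn : ¬ K.Adj x y) : ∃ p q, K.Adj x p ∧ K.Adj q y ∧ (p ≠ x ∧ p ≠ y) ∧ (q ≠ x ∧ q ≠ y) ∧
      Relation.ReflTransGen (StepIn K {v | v ≠ x ∧ v ≠ y}) q p := by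
  classical
  obtain ⟨w⟩ := h
  have hw := w.toPath.2
  generalize (w.toPath : K.Walk x y) = w' at hw
  cases w' with
  | nil => exact absurd rfl hne
  | @cons _ p _ h r =>
    rw [SimpleGraph.Walk.cons_isPath_iff] at hw
    have hpy : p ≠ y := by rintro rfl; exact hn h
    obtain ⟨q, hq, hqx, hqy, hr⟩ := exists_inner_chain_of_walk r hw.2 hpy
    exact ⟨p, q, h, hq, ⟨h.ne', hpy⟩, ⟨hqx, hqy⟩, hr⟩

theorem graphX_weakInducedMinor_of_reachable {L : LinkGraph V} {u x y : V} {i : Bool}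
    (hxy : x ≠ y) (hN : ∀ a, L.tot.Adj u a → a = x ∨ a = y) (hux : ∀ i, (L.link i).Adj u x)
    (huy : ∀ i, (L.link i).Adj u y) (eux : ¬ L.edge.Adj u x) (euy : ¬ L.edge.Adj u y)
    (hi : ¬ (L.link i).Adj x y) (hi' : (L.link !i).Adj x y) (exy : ¬ L.edge.Adj x y)
    (hr : ((L.cut {u}).tot.deleteEdges {s(x, y)}).Reachable x y) :
    IsWeakInducedMinor graphX L.expand := by
  have hK : ∀ a b, ((L.cut {u}).tot.deleteEdges {s(x, y)}).Adj a b →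
      L.tot.Adj a b ∧ a ≠ u ∧ b ≠ u := by
    intro a b h
    rw [SimpleGraph.deleteEdges_adj] at h
    rcases h.1 with h | ⟨j, h⟩
    · exact ⟨.inl h.1, h.2⟩
    · exact ⟨.inr ⟨j, h.1⟩, h.2⟩
  obtain ⟨p, q, hp, hq, hp', hq', hqp⟩ := exists_inner_chain hr hxy (by
    rw [SimpleGraph.deleteEdges_adj]; simp)
  set S : Set V := {v | v ≠ x ∧ v ≠ y ∧ v ≠ u} with hS
  set I : Set V := {w | Relation.ReflTransGen (StepIn L.tot S) w p} with hI
  have hpS : p ∈ S := ⟨hp'.1, hp'.2, (hK _ _ hp).2.2⟩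
  have hIS : ∀ w ∈ I, w ∈ S := by
    intro w hw
    rcases Relation.ReflTransGen.cases_head hw with rfl | ⟨c, h, _⟩
    · exact hpS
    · exact h.2.1
  have hpI : p ∈ I := Relation.ReflTransGen.refl
  have hqI : q ∈ I := by
    refine Relation.ReflTransGen.mono ?_ _ _ hqp
    rintro a b ⟨h, ha, hb⟩
    have := hK a b h
    exact ⟨this.1, ⟨ha.1, ha.2, this.2.1⟩, ⟨hb.1, hb.2, this.2.2⟩⟩
  have hxI : x ∉ I := fun h => (hIS x h).1 rfl
  have hyI : y ∉ I := fun h => (hIS y h).2.1 rfl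
  have huI : u ∉ I := fun h => (hIS u h).2.2 rfl
  refine IsWeakInducedMinor.trans ?_ (expand_cut_addLink L (I := I) (p := p) hxy hxI hyI hi
    ?_ ?_ ⟨p, hpI, (hK _ _ hp).1⟩ ⟨q, hqI, (hK _ _ hq).1.symm⟩)
  · refine graphX_weakInducedMinor (a := u) (b := x) (c := y) (d := y) (hux true).ne
      (huy true).ne' hxy.symm (huy true).ne' hxy.symm ?_ ?_ ?_ (.inl rfl) ?_
    · exact fun j => .inl ⟨hux j, huI, hxI⟩
    · exact fun j => .inl ⟨(huy j).symm, hyI, huI⟩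
    · intro j
      by_cases hj : j = i
      · exact .inr ⟨hj, hxy, rfl⟩
      · obtain rfl : j = !i := by cases i <;> cases j <;> simp_all
        exact .inl ⟨hi', hxI, hyI⟩
    · simp [addLink_edge, cut_edge_adj, *]
  · intro w hw
    induction hw using Relation.ReflTransGen.head_induction_on with
    | refl => exact .refl
    | head h hr ih => exact .head ⟨h.1, .head h hr, hr⟩ ih
  · intro a b h ha hb
    by_contra! hcon
    by_cases hbu : b = u
    · subst hbu
      rcases hN a h.symm with rfl | rfl
      · exact hxI ha
      · exact hyI ha
    · exact hb (.head ⟨h.symm, ⟨hcon.1, hcon.2, hbu⟩, hIS a ha⟩ ha)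

theorem bypass_tot_adj {L : LinkGraph V} {u x y a b : V} :
    (L.bypass u x y).tot.Adj a b ↔ (L.tot.Adj a b ∧ a ≠ u ∧ b ≠ u) ∨
      (a ≠ b ∧ (a = x ∧ b = y ∨ a = y ∧ b = x)) := by
  simp only [tot_adj, bypass_edge_adj, bypass_link_adj, Sym2.eq_iff, Bool.exists_bool]
  grind

/-- A pair joined by two paths but by no edge. -/
def Virt (L : LinkGraph V) (a b : V) : Prop :=
  ¬ L.edge.Adj a b ∧ ∀ i, (L.link i).Adj a b

theorem Virt.symm {L : LinkGraph V} {a b : V} (h : L.Virt a b) : L.Virt b a :=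
  ⟨fun h' => h.1 h'.symm, fun i => (h.2 i).symm⟩

theorem Virt.tot {L : LinkGraph V} {a b : V} (h : L.Virt a b) : L.tot.Adj a b :=
  .inr ⟨true, h.2 true⟩

theorem bypass_virt {L : LinkGraph V} {u x y a b : V} (h : L.Virt a b) (ha : a ≠ u) (hb : b ≠ u) :
    (L.bypass u x y).Virt a b :=
  ⟨fun h' => h.1 (bypass_edge_adj.1 h').1, fun i => bypass_link_adj.2 (.inl ⟨h.2 i, ha, hb⟩)⟩

/-- Vertices of degree two that cannot be eliminated. -/
def Bad (L : LinkGraph V) (u : V) : Prop :=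
  ∃ x y, x ≠ y ∧ L.Virt u x ∧ L.Virt u y ∧ ¬ L.tot.Adj x y ∧ ∀ a, L.tot.Adj u a → a = x ∨ a = y

/-- Vertices of degree at least three. -/
def Busy (L : LinkGraph V) (u : V) : Prop :=
  ∃ x y z, x ≠ y ∧ x ≠ z ∧ y ≠ z ∧ L.tot.Adj u x ∧ L.tot.Adj u y ∧ L.tot.Adj u z

theorem bad_or_busy_bypass_left {L : LinkGraph V} {v x y : V}
    (hX : ¬ IsWeakInducedMinor graphX L.expand)
    (hxy : x ≠ y) (hvx : L.Virt v x) (hvy : L.Virt v y) (hn : ¬ L.tot.Adj x y)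
    (h : L.Bad x ∨ L.Busy x) : (L.bypass v x y).Bad x ∨ (L.bypass v x y).Busy x := by
  have hxv := hvx.tot.ne'
  have hyv := hvy.tot.ne'
  rcases h with h | ⟨p, q, r, hpq, hpr, hqr, hp, hq, hr⟩
  · left
    obtain ⟨q, hq, hqv, hvq, hnb⟩ : ∃ q, L.Virt x q ∧ q ≠ v ∧ ¬ L.tot.Adj v q ∧
        ∀ a, L.tot.Adj x a → a = v ∨ a = q := by
      obtain ⟨p, q, hne, hp, hq, hpq, hnb⟩ := h
      rcases hnb v hvx.symm.tot with rfl | rfl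
      · exact ⟨q, hq, hne.symm, hpq, hnb⟩
      · exact ⟨p, hp, hne, fun h => hpq h.symm, fun a ha => (hnb a ha).symm⟩
    have hqy : q ≠ y := by rintro rfl; exact hvq hvy.tot
    have hqx := hq.tot.ne'
    by_cases hyq : L.tot.Adj y q
    · refine absurd (graphX_weakInducedMinor (a := v) (b := x) (c := y) (d := q) hxv.symm hyv
        hxy.symm hqv hqx hvx.2 hvy.symm.2 hq.2 (.inr hyq)
        ⟨hvx.1, hvy.1, fun h => hvq (.inl h), fun h => hn (.inl h), hq.1⟩) hX
    · refine ⟨y, q, hqy.symm, ⟨?_, ?_⟩, bypass_virt hq hxv hqv, ?_, ?_⟩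
      · exact fun h => hn (.inl (bypass_edge_adj.1 h).1)
      · exact fun i => bypass_link_adj.2 (.inr ⟨hxy, rfl⟩)
      · rw [bypass_tot_adj]; grind
      · intro a
        rw [bypass_tot_adj]; grind
  · right
    have key : ∀ a, L.tot.Adj x a → a ≠ v → (L.bypass v x y).tot.Adj x a := fun a ha hav =>
      bypass_tot_adj.2 (.inl ⟨ha, hxv, hav⟩)
    have key' : (L.bypass v x y).tot.Adj x y := bypass_tot_adj.2 (.inr (by simp [hxy]))
    have hne : ∀ a, L.tot.Adj x a → a ≠ y := by rintro a ha rfl; exact hn ha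
    have := hne p hp; have := hne q hq; have := hne r hr
    by_cases h1 : p = v
    · exact ⟨y, q, r, by grind, by grind, hqr, key', key _ hq (by grind), key _ hr (by grind)⟩
    by_cases h2 : q = v
    · exact ⟨p, y, r, by grind, by grind, by grind, key _ hp h1, key', key _ hr (by grind)⟩
    by_cases h3 : r = v
    · exact ⟨p, q, y, by grind, by grind, by grind, key _ hp h1, key _ hq h2, key'⟩
    exact ⟨p, q, r, hpq, hpr, hqr, key _ hp h1, key _ hq h2, key _ hr h3⟩

theorem graphX_weakInducedMinor_of_bad_or_busy [Finite V] {L : LinkGraph V}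
    (hw : HasWidthTwo L.tot) {a₀ b₀ : V} (hab : L.tot.Adj a₀ b₀)
    (hL : ∀ u a, L.tot.Adj u a → L.Bad u ∨ L.Busy u) :
    IsWeakInducedMinor graphX L.expand := by
  generalize hn : {a | ∃ b, L.tot.Adj a b}.ncard = n
  induction n using Nat.strong_induction_on generalizing L a₀ b₀ with
  | _ n ih =>
  by_contra hX
  obtain ⟨v, hv, hvbad⟩ : ∃ v, L.Bad v ∧ True := by
    obtain ⟨v, x, y, hx, hy, hnb⟩ := hw.exists_low_degree hab
    refine ⟨v, (hL v x hx).resolve_right ?_, trivial⟩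
    rintro ⟨p, q, r, hpq, hpr, hqr, hp, hq, hr⟩
    have := hnb p hp; have := hnb q hq; have := hnb r hr
    grind
  clear hvbad
  obtain ⟨x, y, hxy, hvx, hvy, hnxy, hnb⟩ := hv
  have hxv := hvx.tot.ne'
  have hyv := hvy.tot.ne'
  refine hX (IsWeakInducedMinor.trans ?_ (expand_bypass L hxy hnb hvx.tot hvy.2 hvy.1 hnxy))
  refine ih {a | ∃ b, (L.bypass v x y).tot.Adj a b}.ncard ?_ (L := L.bypass v x y) (a₀ := x)
    (b₀ := y) ?_ ?_ ?_ rfl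
  · rw [← hn]
    refine Set.ncard_lt_ncard ?_ (Set.toFinite _)
    rw [Set.ssubset_iff_of_subset]
    · refine ⟨v, ⟨x, hvx.tot⟩, ?_⟩
      rintro ⟨b, hb⟩
      rw [bypass_tot_adj] at hb
      grind
    · rintro a ⟨b, hb⟩
      rw [bypass_tot_adj] at hb
      rcases hb with hb | ⟨_, ⟨rfl, rfl⟩ | ⟨rfl, rfl⟩⟩
      · exact ⟨b, hb.1⟩
      · exact ⟨v, hvx.symm.tot⟩
      · exact ⟨v, hvy.symm.tot⟩
  · refine hw.contract hvx.tot ?_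
    intro a b h
    rw [bypass_tot_adj] at h
    have := hvy.tot
    grind
  · exact bypass_tot_adj.2 (.inr (by simp [hxy]))
  · intro u a hua
    rw [bypass_tot_adj] at hua
    by_cases hux : u = x
    · subst hux
      exact bad_or_busy_bypass_left hX hxy hvx hvy hnxy (hL _ _ hvx.symm.tot)
    by_cases huy : u = y
    · subst huy
      rw [bypass_comm]
      exact bad_or_busy_bypass_left hX hxy.symm hvy hvx (fun h => hnxy h.symm)
        (hL _ _ hvy.symm.tot)
    have huv : u ≠ v := by grind
    have hua' : L.tot.Adj u a := by grind
    have hnv : ∀ b, L.tot.Adj u b → b ≠ v := by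
      rintro b hb rfl
      exact (hnb u hb.symm).elim hux huy
    have key : ∀ b, L.tot.Adj u b → (L.bypass v x y).tot.Adj u b := fun b hb =>
      bypass_tot_adj.2 (.inl ⟨hb, huv, hnv b hb⟩)
    rcases hL u a hua' with ⟨p, q, hpq, hp, hq, hnpq, hup⟩ | ⟨p, q, r, hpq, hpr, hqr, hp, hq, hr⟩
    · left
      by_cases hcase : L.Virt u x ∧ L.Virt u y
      · exact absurd (graphX_weakInducedMinor (a := v) (b := x) (c := y) (d := u) hxv.symm hyv
          hxy.symm huv hux hvx.2 hvy.symm.2 hcase.1.symm.2 (.inr hcase.2.symm.tot)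
          ⟨hvx.1, hvy.1, fun h => hnv v (.inl h.symm) rfl, fun h => hnxy (.inl h),
            hcase.1.symm.1⟩) hX
      · refine ⟨p, q, hpq, bypass_virt hp huv (hnv _ hp.tot), bypass_virt hq huv (hnv _ hq.tot),
          ?_, ?_⟩
        · rw [bypass_tot_adj]; grind
        · intro b
          rw [bypass_tot_adj]; grind
    · exact .inr ⟨p, q, r, hpq, hpr, hqr, key _ hp, key _ hq, key _ hr⟩

theorem reachable_of_adj {K K' : SimpleGraph V} (h : ∀ a b, K.Adj a b → K'.Reachable a b)
    {p q : V} (hr : K.Reachable p q) : K'.Reachable p q := by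
  obtain ⟨w⟩ := hr
  induction w with
  | nil => exact .rfl
  | cons h' _ ih => exact (h _ _ h').trans ih

/-- The pair `ab` witnesses that the triangle `abz` of `T` is not independent, even after
the virtual edges of `L` have been removed. -/
def Good (L : LinkGraph V) (T : SimpleGraph V) (a b z : V) : Prop :=
  L.edge.Adj a b ∨ (L.tot.Adj a b ∧ ¬ L.Virt a b ∧ ∀ w, T.Adj a w → T.Adj b w → w = z)

/-- The pair `ab` is not a bridge. -/
def NonBridge (L : LinkGraph V) (a b : V) : Prop :=
  L.tot.Adj a b → (L.tot.deleteEdges {s(a, b)}).Reachable a b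

/-- The conditions imposed on the triangles of a completion. -/
def GoodTriangle (L : LinkGraph V) (T : SimpleGraph V) (a b c : V) : Prop :=
  (L.Good T a b c ∨ L.Good T b c a ∨ L.Good T a c b) ∧
    L.NonBridge a b ∧ L.NonBridge b c ∧ L.NonBridge a c

theorem Good.symm {L : LinkGraph V} {T : SimpleGraph V} {a b z : V} (h : L.Good T a b z) :
    L.Good T b a z :=
  h.imp (fun h => h.symm) (fun h => ⟨h.1.symm, fun h' => h.2.1 h'.symm, fun w h1 h2 => h.2.2 w h2 h1⟩)

theorem NonBridge.symm {L : LinkGraph V} {a b : V} (h : L.NonBridge a b) : L.NonBridge b a := by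
  intro hab
  rw [Sym2.eq_swap]
  exact (h hab.symm).symm

theorem GoodTriangle.swap_left {L : LinkGraph V} {T : SimpleGraph V} {a b c : V}
    (h : L.GoodTriangle T a b c) : L.GoodTriangle T b a c := by
  obtain ⟨h1, h2, h3, h4⟩ := h
  refine ⟨?_, h2.symm, h4, h3⟩
  rcases h1 with h | h | h
  · exact .inl h.symm
  · exact .inr (.inr h)
  · exact .inr (.inl h)

theorem GoodTriangle.swap_right {L : LinkGraph V} {T : SimpleGraph V} {a b c : V}
    (h : L.GoodTriangle T a b c) : L.GoodTriangle T a c b := by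
  obtain ⟨h1, h2, h3, h4⟩ := h
  refine ⟨?_, h4, h3.symm, h2⟩
  rcases h1 with h | h | h
  · exact .inr (.inr h)
  · exact .inr (.inl h.symm)
  · exact .inl h

theorem goodTriangle_of_cases {L : LinkGraph V} {T : SimpleGraph V} (u : V)
    (h₁ : ∀ a b c, a ≠ u → b ≠ u → c ≠ u → T.Adj a b → T.Adj b c → T.Adj a c →
      L.GoodTriangle T a b c)
    (h₂ : ∀ b c, T.Adj u b → T.Adj u c → T.Adj b c → L.GoodTriangle T u b c)
    (a b c : V) (hab : T.Adj a b) (hbc : T.Adj b c) (hac : T.Adj a c) :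
    L.GoodTriangle T a b c := by
  by_cases ha : a = u
  · subst ha
    exact h₂ b c hab hac hbc
  by_cases hb : b = u
  · subst hb
    exact (h₂ a c hab.symm hbc hac).swap_left
  by_cases hc : c = u
  · subst hc
    exact (h₂ a b hac.symm hbc.symm hab).swap_left.swap_right
  exact h₁ a b c ha hb hc hab hbc hac

/-- A chordal supergraph without `K₄` all of whose triangles are good. -/
structure IsCompletion (L : LinkGraph V) (T : SimpleGraph V) : Prop where
  le : ∀ a b, L.tot.Adj a b → T.Adj a b
  supp : ∀ a b, T.Adj a b → ∃ c, L.tot.Adj a c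
  dirac : Dirac T
  noK4 : NoK4 T
  tri : ∀ a b c, T.Adj a b → T.Adj b c → T.Adj a c → L.GoodTriangle T a b c

/-- `L'` arises from `L` by deleting the vertex `u`, whose neighbours are `x` and `y`, and
possibly adding links between `x` and `y`. -/
structure Reduct (L L' : LinkGraph V) (u x y : V) : Prop where
  tot_x : L.tot.Adj u x
  tot_y : L.tot.Adj u y
  nbrs : ∀ a, L.tot.Adj u a → a = x ∨ a = y
  edge : ∀ a b, L'.edge.Adj a b ↔ L.edge.Adj a b ∧ a ≠ u ∧ b ≠ u
  link : ∀ a b i, ¬ (a = x ∧ b = y) → ¬ (a = y ∧ b = x) →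
    ((L'.link i).Adj a b ↔ (L.link i).Adj a b ∧ a ≠ u ∧ b ≠ u)
  mono : ∀ i, (L.link i).Adj x y → (L'.link i).Adj x y

namespace Reduct

variable {L L' : LinkGraph V} {u x y : V}

theorem tot_iff (h : Reduct L L' u x y) {a b : V} (h1 : ¬ (a = x ∧ b = y))
    (h2 : ¬ (a = y ∧ b = x)) : L'.tot.Adj a b ↔ L.tot.Adj a b ∧ a ≠ u ∧ b ≠ u := by
  simp only [tot_adj, h.edge, fun i => h.link a b i h1 h2, Bool.exists_bool]
  grind

theorem tot_mono (h : Reduct L L' u x y) {a b : V} (hab : L.tot.Adj a b) (ha : a ≠ u)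
    (hb : b ≠ u) : L'.tot.Adj a b := by
  by_cases h1 : a = x ∧ b = y
  · obtain ⟨rfl, rfl⟩ := h1
    exact hab.imp (fun h' => (h.edge _ _).2 ⟨h', ha, hb⟩) (fun ⟨i, h'⟩ => ⟨i, h.mono i h'⟩)
  by_cases h2 : a = y ∧ b = x
  · obtain ⟨rfl, rfl⟩ := h2
    exact hab.imp (fun h' => (h.edge _ _).2 ⟨h', ha, hb⟩)
      (fun ⟨i, h'⟩ => ⟨i, (h.mono i h'.symm).symm⟩)
  exact (h.tot_iff h1 h2).2 ⟨hab, ha, hb⟩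

theorem ne_of_tot (h : Reduct L L' u x y) {a b : V} (hab : L'.tot.Adj a b) : a ≠ u ∧ b ≠ u := by
  have := h.tot_x.ne; have := h.tot_y.ne
  by_cases h1 : a = x ∧ b = y
  · grind
  by_cases h2 : a = y ∧ b = x
  · grind
  exact ((h.tot_iff h1 h2).1 hab).2

theorem tot_cases (h : Reduct L L' u x y) {a b : V} (hab : L'.tot.Adj a b) :
    L.tot.Adj a b ∨ (a = x ∧ b = y) ∨ (a = y ∧ b = x) := by
  by_contra! hcon
  exact hcon.1 ((h.tot_iff (by grind) (by grind)).1 hab).1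

theorem hasWidthTwo [Finite V] (h : Reduct L L' u x y) (hw : HasWidthTwo L.tot) :
    HasWidthTwo L'.tot := by
  refine hw.contract h.tot_x fun a b hab => ⟨(h.ne_of_tot hab).1, (h.ne_of_tot hab).2, ?_⟩
  rcases h.tot_cases hab with h' | ⟨rfl, rfl⟩ | ⟨rfl, rfl⟩
  · exact .inl h'
  · exact .inr (.inl ⟨rfl, h.tot_y⟩)
  · exact .inr (.inr ⟨rfl, h.tot_y⟩)

theorem ncard_lt [Finite V] (h : Reduct L L' u x y) :
    {a | ∃ b, L'.tot.Adj a b}.ncard < {a | ∃ b, L.tot.Adj a b}.ncard := by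
  refine Set.ncard_lt_ncard ?_ (Set.toFinite _)
  rw [Set.ssubset_iff_of_subset]
  · exact ⟨u, ⟨x, h.tot_x⟩, fun ⟨b, hb⟩ => (h.ne_of_tot hb).1 rfl⟩
  · rintro a ⟨b, hb⟩
    rcases h.tot_cases hb with hb | ⟨rfl, rfl⟩ | ⟨rfl, rfl⟩
    · exact ⟨b, hb⟩
    · exact ⟨u, h.tot_x.symm⟩
    · exact ⟨u, h.tot_y.symm⟩

theorem supp (h : Reduct L L' u x y) {a : V} (ha : ∃ b, L'.tot.Adj a b) : ∃ b, L.tot.Adj a b := by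
  obtain ⟨b, hb⟩ := ha
  rcases h.tot_cases hb with hb | ⟨rfl, rfl⟩ | ⟨rfl, rfl⟩
  · exact ⟨b, hb⟩
  · exact ⟨u, h.tot_x.symm⟩
  · exact ⟨u, h.tot_y.symm⟩

theorem nonBridge (h : Reduct L L' u x y) {a b : V} (ha : a ≠ u) (hb : b ≠ u)
    (hn : L'.NonBridge a b) : L.NonBridge a b := by
  intro hab
  have hr := hn (h.tot_mono hab ha hb)
  refine reachable_of_adj (fun c d hcd => ?_) hr
  rw [SimpleGraph.deleteEdges_adj] at hcd
  obtain ⟨hcd, hne⟩ := hcd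
  by_cases hcd' : L.tot.Adj c d
  · exact SimpleGraph.Adj.reachable (SimpleGraph.deleteEdges_adj.2 ⟨hcd', hne⟩)
  have hux : (L.tot.deleteEdges {s(a, b)}).Adj u x := by
    refine SimpleGraph.deleteEdges_adj.2 ⟨h.tot_x, ?_⟩
    simp; grind
  have huy : (L.tot.deleteEdges {s(a, b)}).Adj u y := by
    refine SimpleGraph.deleteEdges_adj.2 ⟨h.tot_y, ?_⟩
    simp; grind
  rcases (h.tot_cases hcd).resolve_left hcd' with ⟨rfl, rfl⟩ | ⟨rfl, rfl⟩
  · exact hux.symm.reachable.trans huy.reachable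
  · exact huy.symm.reachable.trans hux.reachable

theorem nonBridge_new (h : Reduct L L' u x y) (hxy : x ≠ y)
    (hr : (L'.tot.deleteEdges {s(x, y)}).Reachable x y) :
    L.NonBridge u x ∧ L.NonBridge u y := by
  have hxu := h.tot_x.ne
  have hyu := h.tot_y.ne
  have key : ∀ z, (L.tot.deleteEdges {s(u, z)}).Reachable x y := by
    intro z
    refine reachable_of_adj (fun c d hcd => SimpleGraph.Adj.reachable ?_) hr
    rw [SimpleGraph.deleteEdges_adj] at hcd ⊢
    have := h.tot_cases hcd.1
    have h2 := h.ne_of_tot hcd.1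
    simp at hcd ⊢
    grind
  constructor
  · intro _
    refine (SimpleGraph.Adj.reachable ?_).trans (key x).symm
    rw [SimpleGraph.deleteEdges_adj]
    refine ⟨h.tot_y, ?_⟩
    simp; grind
  · intro _
    refine (SimpleGraph.Adj.reachable ?_).trans (key y)
    rw [SimpleGraph.deleteEdges_adj]
    refine ⟨h.tot_x, ?_⟩
    simp; grind

theorem good (h : Reduct L L' u x y) {T T' : SimpleGraph V} {a b z : V} (ha : a ≠ u) (hb : b ≠ u)
    (hg : L'.Good T' a b z)
    (he : ¬ L.edge.Adj a b → L'.tot.Adj a b → ¬ L'.Virt a b →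
      (∀ w, T'.Adj a w → T'.Adj b w → w = z) → ¬ (a = x ∧ b = y) ∧ ¬ (a = y ∧ b = x) ∧
        ∀ w, T.Adj a w → T.Adj b w → w = z) : L.Good T a b z := by
  by_cases hedge : L.edge.Adj a b
  · exact .inl hedge
  rcases hg with hg | ⟨h1, h2, h3⟩
  · exact .inl ((h.edge a b).1 hg).1
  · obtain ⟨h4, h5, h6⟩ := he hedge h1 h2 h3
    refine .inr ⟨((h.tot_iff h4 h5).1 h1).1, fun hv => h2 ⟨?_, fun i => ?_⟩, h6⟩
    · exact fun h' => hedge ((h.edge a b).1 h').1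
    · exact (h.link a b i h4 h5).2 ⟨hv.2 i, ha, hb⟩

/-- Completing by joining `u` to its two adjacent neighbours. -/
theorem isCompletion_addNbrs (h : Reduct L L' u x y) {T : SimpleGraph V}
    (hT : L'.IsCompletion T) (hxy : x ≠ y → L'.tot.Adj x y)
    (h1 : ∀ z, x ≠ y → T.Adj x z → T.Adj y z →
      L.edge.Adj x y ∨ L'.Virt x y ∨ ∃ w, w ≠ z ∧ T.Adj x w ∧ T.Adj y w)
    (h2 : x ≠ y → L.edge.Adj x y ∨ ¬ L.Virt u x ∨ ¬ L.Virt u y ∨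
      (L.tot.Adj x y ∧ ¬ L.Virt x y ∧ ∀ z, T.Adj x z → T.Adj y z → False))
    (h3 : x ≠ y → L.tot.Adj x y ∨ (L'.tot.deleteEdges {s(x, y)}).Reachable x y) :
    L.IsCompletion (addNbrs T u {x, y}) := by
  have hux := h.tot_x.ne
  have huy := h.tot_y.ne
  have huT : ∀ a, ¬ T.Adj u a := fun a ha => by
    obtain ⟨c, hc⟩ := hT.supp _ _ ha
    exact (h.ne_of_tot hc).1 rfl
  have huT' : ∀ a, ¬ T.Adj a u := fun a ha => huT a ha.symm
  have hadj : ∀ a b, (addNbrs T u {x, y}).Adj a b ↔ T.Adj a b ∨ (a = u ∧ (b = x ∨ b = y)) ∨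
      (b = u ∧ (a = x ∨ a = y)) := by
    intro a b
    simp only [addNbrs_adj, Set.mem_insert_iff, Set.mem_singleton_iff]
    grind
  have hTxy : x ≠ y → T.Adj x y := fun hne => hT.le _ _ (hxy hne)
  refine ⟨?_, ?_, ?_, hT.noK4.addNbrs huT, ?_⟩
  · intro a b hab
    rw [hadj]
    by_cases ha : a = u
    · subst ha
      exact .inr (.inl ⟨rfl, h.nbrs b hab⟩)
    by_cases hb : b = u
    · subst hb
      exact .inr (.inr ⟨rfl, h.nbrs a hab.symm⟩)
    exact .inl (hT.le _ _ (h.tot_mono hab ha hb))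
  · intro a b hab
    rw [hadj] at hab
    rcases hab with hab | ⟨rfl, _⟩ | ⟨rfl, rfl | rfl⟩
    · exact h.supp (hT.supp _ _ hab)
    · exact ⟨x, h.tot_x⟩
    · exact ⟨b, h.tot_x.symm⟩
    · exact ⟨b, h.tot_y.symm⟩
  · refine hT.dirac.addNbrs huT ?_
    have hs : x ≠ y → T.Adj y x := fun hne => (hTxy hne).symm
    simp only [Set.mem_insert_iff, Set.mem_singleton_iff]
    grind
  · refine goodTriangle_of_cases u ?_ ?_
    · intro a b c ha hb hc hab hbc hac
      rw [hadj] at hab hbc hac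
      have hab : T.Adj a b := by grind
      have hbc : T.Adj b c := by grind
      have hac : T.Adj a c := by grind
      obtain ⟨h4, h5, h6, h7⟩ := hT.tri a b c hab hbc hac
      refine ⟨?_, h.nonBridge ha hb h5, h.nonBridge hb hc h6, h.nonBridge ha hc h7⟩
      have key : ∀ p q r, p ≠ u → q ≠ u → r ≠ u → T.Adj p q → T.Adj p r → T.Adj q r →
          L'.Good T p q r → L.Good (addNbrs T u {x, y}) p q r := by
        intro p q r hp hq hr hpq hpr hqr hg
        refine h.good hp hq hg ?_
        intro he _ hv hex
        have hn1 : ¬ (p = x ∧ q = y) := by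
          rintro ⟨rfl, rfl⟩
          rcases h1 r hpq.ne hpr hqr with h' | h' | ⟨w, hw, h8, h9⟩
          · exact he h'
          · exact hv h'
          · exact hw (hex w h8 h9)
        have hn2 : ¬ (p = y ∧ q = x) := by
          rintro ⟨rfl, rfl⟩
          rcases h1 r hpq.ne' hqr hpr with h' | h' | ⟨w, hw, h8, h9⟩
          · exact he h'.symm
          · exact hv h'.symm
          · exact hw (hex w h9 h8)
        refine ⟨hn1, hn2, ?_⟩
        intro w hw1 hw2
        rw [hadj] at hw1 hw2
        have := hpq.ne
        grind
      rcases h4 with h4 | h4 | h4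
      · exact .inl (key _ _ _ ha hb hc hab hac hbc h4)
      · exact .inr (.inl (key _ _ _ hb hc ha hbc hab.symm hac.symm h4))
      · exact .inr (.inr (key _ _ _ ha hc hb hac hab hbc.symm h4))
    · have hl : ∀ a, ¬ T.Adj a a := fun a => T.irrefl
      have main : x ≠ y → L.GoodTriangle (addNbrs T u {x, y}) u x y := by
        intro hne
        have hnb : (L.NonBridge u x ∧ L.NonBridge u y) ∧ L.NonBridge x y := by
          have hd : ∀ a b, L.tot.Adj a b → (a = u ∨ b = u) →
              (L.tot.deleteEdges {s(x, y)}).Reachable a b := by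
            intro a b hab hu
            refine SimpleGraph.Adj.reachable (SimpleGraph.deleteEdges_adj.2 ⟨hab, ?_⟩)
            simp; grind
          refine ⟨?_, fun _ => (hd _ _ h.tot_x.symm (.inr rfl)).trans (hd _ _ h.tot_y (.inl rfl))⟩
          rcases h3 hne with h' | h'
          · have hxy' : ∀ z, (L.tot.deleteEdges {s(u, z)}).Reachable x y := by
              intro z
              refine SimpleGraph.Adj.reachable (SimpleGraph.deleteEdges_adj.2 ⟨h', ?_⟩)
              simp; grind
            constructor
            · intro _
              refine (SimpleGraph.Adj.reachable (SimpleGraph.deleteEdges_adj.2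
                ⟨h.tot_y, ?_⟩)).trans (hxy' x).symm
              simp; grind
            · intro _
              refine (SimpleGraph.Adj.reachable (SimpleGraph.deleteEdges_adj.2
                ⟨h.tot_x, ?_⟩)).trans (hxy' y)
              simp; grind
          · exact h.nonBridge_new hne h'
        refine ⟨?_, hnb.1.1, hnb.2, hnb.1.2⟩
        rcases h2 hne with h' | h' | h' | ⟨h4, h5, h6⟩
        · exact .inr (.inl (.inl h'))
        · refine .inl (.inr ⟨h.tot_x, h', ?_⟩)
          intro w; rw [hadj, hadj]; grind
        · refine .inr (.inr (.inr ⟨h.tot_y, h', ?_⟩))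
          intro w; rw [hadj, hadj]; grind
        · refine .inr (.inl (.inr ⟨h4, h5, ?_⟩))
          intro w; rw [hadj, hadj]; grind
      intro b c hb hc hbc
      rw [hadj] at hb hc
      have hne := hbc.ne
      have hb' : b = x ∨ b = y := by grind
      have hc' : c = x ∨ c = y := by grind
      rcases hb' with rfl | rfl <;> rcases hc' with rfl | rfl
      · exact absurd rfl hne
      · exact main hne
      · exact (main hne.symm).swap_right
      · exact absurd rfl hne

/-- Completing by flipping the pair `xy`. -/
theorem isCompletion_flipEdge (h : Reduct L L' u x y) {T : SimpleGraph V}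
    (hT : L'.IsCompletion T) (hne : x ≠ y) (hxy : L'.tot.Adj x y) (hn : ¬ L.tot.Adj x y)
    (h1 : ∀ z w, T.Adj x z → T.Adj y z → T.Adj x w → T.Adj y w → z = w)
    (h2 : ∀ z, T.Adj x z → T.Adj y z → ¬ L.Virt u x ∧ ¬ L.Virt u y) :
    L.IsCompletion (flipEdge T u x y) := by
  have hux := h.tot_x.ne
  have huy := h.tot_y.ne
  have huT : ∀ a, ¬ T.Adj u a := fun a ha => by
    obtain ⟨c, hc⟩ := hT.supp _ _ ha
    exact (h.ne_of_tot hc).1 rfl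
  have huT' : ∀ a, ¬ T.Adj a u := fun a ha => huT a ha.symm
  have hl : ∀ a, ¬ T.Adj a a := fun a => T.irrefl
  have hs : ∀ {a b}, T.Adj a b → T.Adj b a := fun h => h.symm
  have hadj : ∀ a b, (flipEdge T u x y).Adj a b ↔
      (T.Adj a b ∧ ¬ (a = x ∧ b = y) ∧ ¬ (a = y ∧ b = x)) ∨
      (a = u ∧ (b = x ∨ b = y ∨ T.Adj x b ∧ T.Adj y b)) ∨
      (b = u ∧ (a = x ∨ a = y ∨ T.Adj x a ∧ T.Adj y a)) := by
    intro a b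
    rw [flipEdge_adj]
    grind
  have hTxy : T.Adj x y := hT.le _ _ hxy
  refine ⟨?_, ?_, hT.dirac.flipEdge huT hTxy h1, hT.noK4.flipEdge huT hTxy h1, ?_⟩
  · intro a b hab
    rw [hadj]
    by_cases ha : a = u
    · subst ha
      have := h.nbrs b hab
      exact .inr (.inl ⟨rfl, by grind⟩)
    by_cases hb : b = u
    · subst hb
      have := h.nbrs a hab.symm
      exact .inr (.inr ⟨rfl, by grind⟩)
    refine .inl ⟨hT.le _ _ (h.tot_mono hab ha hb), ?_, ?_⟩
    · rintro ⟨rfl, rfl⟩; exact hn hab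
    · rintro ⟨rfl, rfl⟩; exact hn hab.symm
  · intro a b hab
    rw [hadj] at hab
    rcases hab with hab | ⟨rfl, _⟩ | ⟨rfl, rfl | rfl | hab⟩
    · exact h.supp (hT.supp _ _ hab.1)
    · exact ⟨x, h.tot_x⟩
    · exact ⟨b, h.tot_x.symm⟩
    · exact ⟨b, h.tot_y.symm⟩
    · exact h.supp (hT.supp _ _ hab.1.symm)
  · refine goodTriangle_of_cases u ?_ ?_
    · intro a b c ha hb hc hab hbc hac
      rw [hadj] at hab hbc hac
      have hab := hab.resolve_right (by grind)
      have hbc := hbc.resolve_right (by grind)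
      have hac := hac.resolve_right (by grind)
      obtain ⟨h4, h5, h6, h7⟩ := hT.tri a b c hab.1 hbc.1 hac.1
      refine ⟨?_, h.nonBridge ha hb h5, h.nonBridge hb hc h6, h.nonBridge ha hc h7⟩
      have key : ∀ p q r, p ≠ u → q ≠ u → T.Adj p q →
          ¬ (p = x ∧ q = y) ∧ ¬ (p = y ∧ q = x) → ¬ (p = x ∧ r = y) ∧ ¬ (p = y ∧ r = x) →
          ¬ (q = x ∧ r = y) ∧ ¬ (q = y ∧ r = x) →
          L'.Good T p q r → L.Good (flipEdge T u x y) p q r := by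
        intro p q r hp hq hpq h8 h9 h10 hg
        refine h.good hp hq hg ?_
        intro _ _ _ hex
        refine ⟨h8.1, h8.2, ?_⟩
        intro w hw1 hw2
        rw [hadj] at hw1 hw2
        have := hpq.ne
        by_cases hwu : w = u
        · exfalso
          subst hwu
          have hw1 : p = x ∨ p = y ∨ T.Adj x p ∧ T.Adj y p := by grind
          have hw2 : q = x ∨ q = y ∨ T.Adj x q ∧ T.Adj y q := by grind
          rcases hw1 with rfl | rfl | hw1 <;> rcases hw2 with rfl | rfl | hw2
          · grind
          · grind
          · have := hex y hTxy (hs hw2.2); grind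
          · grind
          · grind
          · have := hex x hTxy.symm (hs hw2.1); grind
          · have := hex y (hs hw1.2) hTxy; grind
          · have := hex x (hs hw1.1) hTxy.symm; grind
          · exact this (h1 _ _ hw1.1 hw1.2 hw2.1 hw2.2)
        · exact hex w (by grind) (by grind)
      rcases h4 with h4 | h4 | h4
      · exact .inl (key _ _ _ ha hb hab.1 hab.2 hac.2 hbc.2 h4)
      · exact .inr (.inl (key _ _ _ hb hc hbc.1 hbc.2 (by grind) (by grind) h4))
      · exact .inr (.inr (key _ _ _ ha hc hac.1 hac.2 hab.2 (by grind) h4))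
    · have main : ∀ z, T.Adj x z → T.Adj y z → L.GoodTriangle (flipEdge T u x y) u x z ∧
          L.GoodTriangle (flipEdge T u x y) u y z := by
        intro z hxz hyz
        obtain ⟨h3, h4⟩ := h2 z hxz hyz
        obtain ⟨-, h5, h6, h7⟩ := hT.tri x y z hTxy hyz hxz
        obtain ⟨h8, h9⟩ := h.nonBridge_new hne (h5 hxy)
        have hzu : z ≠ u := by rintro rfl; exact huT' _ hxz
        have hzx := hxz.ne; have hzy := hyz.ne
        have huz : L.NonBridge u z := fun h' => by
          rcases h.nbrs z h' with rfl | rfl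
          · exact absurd rfl hzx
          · exact absurd rfl hzy
        refine ⟨⟨.inl (.inr ⟨h.tot_x, h3, ?_⟩), h8, h.nonBridge hux.symm hzu h7, huz⟩,
          ⟨.inl (.inr ⟨h.tot_y, h4, ?_⟩), h9, h.nonBridge huy.symm hzu h6, huz⟩⟩
        · intro w; rw [hadj, hadj]; grind
        · intro w; rw [hadj, hadj]; grind
      intro b c hb hc hbc
      have hne' := hbc.ne
      rw [hadj] at hb hc hbc
      have hb' : b = x ∨ b = y ∨ T.Adj x b ∧ T.Adj y b := by grind
      have hc' : c = x ∨ c = y ∨ T.Adj x c ∧ T.Adj y c := by grind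
      rcases hb' with rfl | rfl | hb' <;> rcases hc' with rfl | rfl | hc'
      · exact absurd rfl hne'
      · grind
      · exact (main c hc'.1 hc'.2).1
      · grind
      · exact absurd rfl hne'
      · exact (main c hc'.1 hc'.2).2
      · exact (main b hb'.1 hb'.2).1.swap_right
      · exact (main b hb'.1 hb'.2).2.swap_right
      · exact absurd (h1 _ _ hb'.1 hb'.2 hc'.1 hc'.2) hne'

end Reduct

theorem reduct_cut {L : LinkGraph V} {u x y : V} (hux : L.tot.Adj u x) (huy : L.tot.Adj u y)
    (hN : ∀ a, L.tot.Adj u a → a = x ∨ a = y) : Reduct L (L.cut {u}) u x y where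
  tot_x := hux
  tot_y := huy
  nbrs := hN
  edge _ _ := Iff.rfl
  link _ _ _ _ _ := Iff.rfl
  mono _ h := ⟨h, hux.ne', huy.ne'⟩

theorem reduct_cut_addLink {L : LinkGraph V} {u x y : V} (i : Bool) (hux : L.tot.Adj u x)
    (huy : L.tot.Adj u y) (hN : ∀ a, L.tot.Adj u a → a = x ∨ a = y) :
    Reduct L ((L.cut {u}).addLink i x y) u x y where
  tot_x := hux
  tot_y := huy
  nbrs := hN
  edge _ _ := Iff.rfl
  link a b j h1 h2 := by
    simp only [addLink_link_adj, cut_link_adj, Set.mem_singleton_iff, Sym2.eq_iff]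
    tauto
  mono _ h := .inl ⟨h, hux.ne', huy.ne'⟩

theorem reduct_bypass {L : LinkGraph V} {u x y : V} (hux : L.tot.Adj u x)
    (huy : L.tot.Adj u y) (hN : ∀ a, L.tot.Adj u a → a = x ∨ a = y) :
    Reduct L (L.bypass u x y) u x y where
  tot_x := hux
  tot_y := huy
  nbrs := hN
  edge a b := by simp [bypass_edge_adj]
  link a b j h1 h2 := by
    simp only [bypass_link_adj, Sym2.eq_iff]
    tauto
  mono _ h := by
    rw [bypass_link_adj]
    exact .inl ⟨h, hux.ne', huy.ne'⟩

theorem expand_cut_addLink_singleton (L : LinkGraph V) {u x y : V} {i : Bool} (hxy : x ≠ y)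
    (hux : L.tot.Adj u x) (huy : L.tot.Adj u y) (hN : ∀ a, L.tot.Adj u a → a = x ∨ a = y)
    (h : ¬ (L.link i).Adj x y) :
    IsWeakInducedMinor ((L.cut {u}).addLink i x y).expand L.expand := by
  refine L.expand_cut_addLink (p := u) hxy hux.ne' huy.ne' h ?_ ?_ ⟨u, rfl, hux.symm⟩
    ⟨u, rfl, huy.symm⟩
  · rintro w rfl
    exact .refl
  · rintro a b hab rfl -
    exact hN b hab

/-- One reduction step at a vertex of degree at most two that is neither bad nor busy. -/
theorem exists_isCompletion_step {L : LinkGraph V} {u x y : V}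
    (hX : ¬ IsWeakInducedMinor graphX L.expand) (hux : L.tot.Adj u x) (huy : L.tot.Adj u y)
    (hN : ∀ a, L.tot.Adj u a → a = x ∨ a = y)
    (hbad : x ≠ y → ¬ L.tot.Adj x y → ¬ (L.Virt u x ∧ L.Virt u y))
    (ih : ∀ L', Reduct L L' u x y → IsWeakInducedMinor L'.expand L.expand →
      ∃ T, L'.IsCompletion T) :
    ∃ T, L.IsCompletion T := by
  have hcut := reduct_cut hux huy hN
  by_cases hxy : x = y
  · obtain ⟨T, hT⟩ := ih _ hcut (L.expand_cut _)
    exact ⟨_, hcut.isCompletion_addNbrs hT (absurd hxy) (fun _ => absurd hxy) (absurd hxy)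
      (absurd hxy)⟩
  have hux' := hux.ne
  have huy' := huy.ne
  by_cases hadj : L.tot.Adj x y
  · have hcxy : (L.cut {u}).tot.Adj x y := hcut.tot_mono hadj hux.ne' huy.ne'
    by_cases hedge : L.edge.Adj x y
    · obtain ⟨T, hT⟩ := ih _ hcut (L.expand_cut _)
      exact ⟨_, hcut.isCompletion_addNbrs hT (fun _ => hcxy) (fun _ _ _ _ => .inl hedge)
        (fun _ => .inl hedge) (fun _ => .inl hadj)⟩
    by_cases hvirt : L.Virt x y
    · obtain ⟨T, hT⟩ := ih _ hcut (L.expand_cut _)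
      have hv : (L.cut {u}).Virt x y :=
        ⟨fun h => hvirt.1 h.1, fun i => ⟨hvirt.2 i, hux.ne', huy.ne'⟩⟩
      refine ⟨_, hcut.isCompletion_addNbrs hT (fun _ => hcxy) (fun _ _ _ _ => .inr (.inl hv))
        (fun _ => ?_) (fun _ => .inl hadj)⟩
      by_contra! hcon
      obtain ⟨-, h1, h2, -⟩ := hcon
      exact hX (graphX_weakInducedMinor hux' huy.ne' (Ne.symm hxy) huy.ne' (Ne.symm hxy)
        h1.2 h2.symm.2 hvirt.2 (.inl rfl) ⟨h1.1, h2.1, h2.1, hvirt.1, hvirt.1⟩)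
    obtain ⟨i, hi⟩ : ∃ i, ¬ (L.link i).Adj x y := by
      by_contra! h
      exact hvirt ⟨hedge, h⟩
    have hi' : (L.link !i).Adj x y := by
      obtain ⟨j, hj⟩ := hadj.resolve_left hedge
      obtain rfl : j = !i := by
        rw [Bool.eq_not]
        rintro rfl
        exact hi hj
      exact hj
    by_cases hboth : L.Virt u x ∧ L.Virt u y
    · obtain ⟨T, hT⟩ := ih _ hcut (L.expand_cut _)
      have hno : ∀ z, T.Adj x z → T.Adj y z → False := fun z h1 h2 =>
        hX (graphX_weakInducedMinor_of_reachable hxy hN hboth.1.2 hboth.2.2 hboth.1.1 hboth.2.1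
          hi hi' hedge ((hT.tri x y z (hT.le _ _ hcxy) h2 h1).2.1 hcxy))
      exact ⟨_, hcut.isCompletion_addNbrs hT (fun _ => hcxy) (fun z _ h1 h2 => (hno z h1 h2).elim)
        (fun _ => .inr (.inr (.inr ⟨hadj, hvirt, hno⟩))) (fun _ => .inl hadj)⟩
    have hred := reduct_cut_addLink i hux huy hN
    obtain ⟨T, hT⟩ := ih _ hred (L.expand_cut_addLink_singleton hxy hux huy hN hi)
    have hv : ((L.cut {u}).addLink i x y).Virt x y := by
      refine ⟨fun h => hedge h.1, fun j => ?_⟩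
      by_cases hj : j = i
      · exact .inr ⟨hj, hxy, rfl⟩
      · obtain rfl : j = !i := by rwa [Bool.eq_not]
        exact .inl ⟨hi', hux.ne', huy.ne'⟩
    exact ⟨_, hred.isCompletion_addNbrs hT (fun _ => hv.tot) (fun _ _ _ _ => .inr (.inl hv))
      (fun _ => by tauto) (fun _ => .inl hadj)⟩
  have hnot := hbad hxy hadj
  have hedge : ¬ L.edge.Adj x y := fun h => hadj (.inl h)
  have hlink : ∀ i, ¬ (L.link i).Adj x y := fun i h => hadj (.inr ⟨i, h⟩)
  by_cases hone : L.Virt u x ∨ L.Virt u y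
  · have hred := reduct_bypass hux huy hN
    have hle : IsWeakInducedMinor (L.bypass u x y).expand L.expand := by
      rcases hone with h | h
      · rw [bypass_comm]
        exact L.expand_bypass (Ne.symm hxy) (fun a ha => (hN a ha).symm) huy h.2 h.1
          (fun h => hadj h.symm)
      · exact L.expand_bypass hxy hN hux h.2 h.1 hadj
    obtain ⟨T, hT⟩ := ih _ hred hle
    have hv : (L.bypass u x y).Virt x y := by
      refine ⟨fun h => hedge (bypass_edge_adj.1 h).1, fun j => bypass_link_adj.2 (.inr ⟨hxy, rfl⟩)⟩
    by_cases hcom : ∃ z, T.Adj x z ∧ T.Adj y z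
    · obtain ⟨z, h1, h2⟩ := hcom
      exact ⟨_, hred.isCompletion_addNbrs hT (fun _ => hv.tot) (fun _ _ _ _ => .inr (.inl hv))
        (fun _ => by tauto)
        (fun _ => .inr ((hT.tri x y z (hT.le _ _ hv.tot) h2 h1).2.1 hv.tot))⟩
    · exact ⟨_, hred.isCompletion_flipEdge hT hxy hv.tot hadj
        (fun z _ h1 h2 => (hcom ⟨z, h1, h2⟩).elim) (fun z h1 h2 => (hcom ⟨z, h1, h2⟩).elim)⟩
  push Not at hone
  have hred := reduct_cut_addLink false hux huy hN
  obtain ⟨T, hT⟩ := ih _ hred (L.expand_cut_addLink_singleton hxy hux huy hN (hlink _))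
  have ht : ((L.cut {u}).addLink false x y).tot.Adj x y := .inr ⟨false, .inr ⟨rfl, hxy, rfl⟩⟩
  by_cases hcom : ∀ z w, T.Adj x z → T.Adj y z → T.Adj x w → T.Adj y w → z = w
  · exact ⟨_, hred.isCompletion_flipEdge hT hxy ht hadj hcom (fun _ _ _ => hone)⟩
  push Not at hcom
  obtain ⟨z, w, h1, h2, h3, h4, hzw⟩ := hcom
  refine ⟨_, hred.isCompletion_addNbrs hT (fun _ => ht) (fun v _ _ _ => .inr (.inr ?_))
    (fun _ => .inr (.inl hone.1))
    (fun _ => .inr ((hT.tri x y z (hT.le _ _ ht) h2 h1).2.1 ht))⟩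
  by_cases hzv : z = v
  · exact ⟨w, fun h => hzw (hzv.trans h.symm), h3, h4⟩
  · exact ⟨z, hzv, h1, h2⟩

theorem exists_isCompletion [Finite V] {L : LinkGraph V} (hw : HasWidthTwo L.tot)
    (hX : ¬ IsWeakInducedMinor graphX L.expand) : ∃ T, L.IsCompletion T := by
  induction hn : {a | ∃ b, L.tot.Adj a b}.ncard using Nat.strong_induction_on generalizing L with
  | _ n ih =>
  by_cases hne : ∃ a b, L.tot.Adj a b
  swap
  · push Not at hne
    refine ⟨⊥, fun a b h => (hne a b h).elim, fun _ _ h => h.elim, fun S => ?_,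
      fun _ _ _ _ h => h.elim, fun _ _ _ h => h.elim⟩
    by_cases hS : ∃ s ∈ S, ∃ t ∈ S, s ≠ t
    · obtain ⟨s, hs, t, ht, hst⟩ := hS
      exact .inr ⟨s, t, hst, id, ⟨hs, fun _ _ _ _ h => h.elim⟩, ht, fun _ _ _ _ h => h.elim⟩
    · push Not at hS
      exact .inl fun p hp q hq hpq => (hpq (hS p hp q hq)).elim
  obtain ⟨a₀, b₀, hab⟩ := hne
  obtain ⟨u, x, hux, hbad, hbusy⟩ : ∃ u a, L.tot.Adj u a ∧ ¬ L.Bad u ∧ ¬ L.Busy u := by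
    by_contra! hcon
    refine hX (graphX_weakInducedMinor_of_bad_or_busy hw hab fun u a h => ?_)
    by_contra! h'
    exact h'.2 (hcon u a h h'.1)
  obtain ⟨y, huy, hN⟩ : ∃ y, L.tot.Adj u y ∧ ∀ a, L.tot.Adj u a → a = x ∨ a = y := by
    by_cases h : ∃ y, L.tot.Adj u y ∧ x ≠ y
    · obtain ⟨y, huy, hxy⟩ := h
      refine ⟨y, huy, fun a ha => ?_⟩
      by_contra! h
      exact hbusy ⟨x, y, a, hxy, h.1.symm, h.2.symm, hux, huy, ha⟩
    · push Not at h
      exact ⟨x, hux, fun a ha => .inl (h a ha).symm⟩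
  refine exists_isCompletion_step hX hux huy hN
    (fun h1 h2 h3 => hbad ⟨x, y, h1, h3.1, h3.2, h2, hN⟩) fun L' hred hle => ?_
  exact ih _ (hn ▸ hred.ncard_lt) (hred.hasWidthTwo hw) (fun h => hX (h.trans hle)) rfl

end LinkGraph

theorem cycleGraph_adj_iff_lt {k : ℕ} {i j : Fin (k + 1)} (hij : i < j) :
    (SimpleGraph.cycleGraph (k + 1)).Adj i j ↔ j.val = i.val + 1 ∨ (i.val = 0 ∧ j.val = k) := by
  rw [SimpleGraph.cycleGraph_adj', Fin.coe_sub_iff_lt.2 hij, Fin.coe_sub_iff_le.2 hij.le]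
  have := j.2
  rw [Fin.lt_def] at hij
  omega

theorem IsChordal.exists_common_nbr {V : Type} {G : SimpleGraph V} (hG : IsChordal G) {a b : V}
    (hab : G.Adj a b) (hr : (G.deleteEdges {s(a, b)}).Reachable a b) :
    ∃ c, G.Adj a c ∧ G.Adj c b := by
  set K := G.deleteEdges {s(a, b)} with hK
  have hKadj : ∀ {p q}, K.Adj p q ↔ G.Adj p q ∧ ¬ (p = a ∧ q = b) ∧ ¬ (p = b ∧ q = a) := by
    intro p q
    simp [hK]
  obtain ⟨w, hw⟩ := hr.exists_walk_length_eq_dist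
  set k := w.length with hk
  have hdist : ∀ i ≤ k, K.dist a (w.getVert i) = i := by
    intro i hi
    have h1 : K.dist a (w.getVert i) ≤ i :=
      ((SimpleGraph.dist_le (w.take i))).trans (by simp)
    have h2 : K.dist (w.getVert i) b ≤ k - i :=
      ((SimpleGraph.dist_le (w.drop i))).trans (by simp [hk])
    have h3 : K.dist a b ≤ K.dist a (w.getVert i) + K.dist (w.getVert i) b :=
      SimpleGraph.Reachable.dist_triangle_left ⟨w.take i⟩ b
    omega
  have hstep : ∀ i < k, G.Adj (w.getVert i) (w.getVert (i + 1)) := fun i hi =>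
    (hKadj.1 (w.adj_getVert_succ hi)).1
  have hzero : w.getVert 0 = a := w.getVert_zero
  have hlast : w.getVert k = b := w.getVert_length
  have hk2 : 2 ≤ k := by
    by_contra! h
    interval_cases h0 : k
    · exact hab.ne (hzero.symm.trans hlast)
    · have := w.adj_getVert_succ (i := 0) (by omega)
      rw [hzero, zero_add, hlast] at this
      exact (hKadj.1 this).2.1 ⟨rfl, rfl⟩
  rcases hk2.eq_or_lt with h2 | h3
  · refine ⟨w.getVert 1, ?_, ?_⟩
    · simpa [hzero] using hstep 0 (by omega)
    · have := hstep 1 (by omega)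
      rwa [show 1 + 1 = k from h2, hlast] at this
  exfalso
  let v : Fin (k + 1) → V := fun i => w.getVert i
  have hd : ∀ i : Fin (k + 1), K.dist a (v i) = i.val := fun i => hdist i (by omega)
  have hinj : Function.Injective v := fun i j h => by
    ext
    rw [← hd i, ← hd j, h]
  have hlt : ∀ i j : Fin (k + 1), i < j →
      (G.Adj (v i) (v j) ↔ (SimpleGraph.cycleGraph (k + 1)).Adj i j) := by
    intro i j hij
    rw [cycleGraph_adj_iff_lt hij]
    refine ⟨fun h => ?_, ?_⟩
    · by_cases h' : K.Adj (v i) (v j)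
      · left
        have h1 : K.dist a (v j) ≤ K.dist a (v i) + K.dist (v i) (v j) :=
          SimpleGraph.Reachable.dist_triangle_left ⟨w.take i⟩ _
        rw [SimpleGraph.dist_eq_one_iff_adj.2 h', hd, hd] at h1
        rw [Fin.lt_def] at hij
        omega
      · right
        have h1 : v 0 = a := hzero
        have h2 : v (Fin.last k) = b := hlast
        rw [hKadj] at h'
        rcases (by tauto : (v i = a ∧ v j = b) ∨ (v i = b ∧ v j = a)) with h' | h'
        · have h3 : i = 0 := hinj (h'.1.trans h1.symm)
          have h4 : j = Fin.last k := hinj (h'.2.trans h2.symm)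
          simp [h3, h4]
        · have h3 : j = 0 := hinj (h'.2.trans h1.symm)
          simp [h3] at hij
    · rintro (h | ⟨h1, h2⟩)
      · have := hstep i.val (by omega)
        rwa [← h] at this
      · simp only [v, h1, h2, hzero, hlast]
        exact hab
  refine hG (k + 1) (by omega) ⟨Set.range v, ⟨Equiv.ofInjective v hinj, ?_⟩⟩
  intro i j
  simp only [SimpleGraph.comap_adj, Equiv.ofInjective_apply, Function.Embedding.subtype_apply]
  rcases lt_trichotomy i j with h | rfl | h
  · exact hlt i j h
  · simp
  · rw [G.adj_comm, SimpleGraph.adj_comm _ i]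
    exact hlt j i h

theorem le_cliqueNumber {V : Type} [Finite V] {G : SimpleGraph V} {n : ℕ} {s : Finset V}
    (hs : G.IsNClique n s) : n ≤ cliqueNumber G := by
  have := Fintype.ofFinite V
  exact le_csSup ⟨Fintype.card V, fun m ⟨t, ht⟩ => ht.card_eq ▸ t.card_le_univ⟩ ⟨s, hs⟩

theorem cliqueNumber_le {V : Type} {G : SimpleGraph V} {n : ℕ} (h : G.CliqueFree (n + 1)) :
    cliqueNumber G ≤ n := by
  refine csSup_le ⟨0, ∅, by simp⟩ ?_
  rintro m ⟨s, hs⟩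
  by_contra! hm
  exact (h.mono hm) s hs

theorem NoK4.cliqueFree {V : Type} {G : SimpleGraph V} (h : NoK4 G) : G.CliqueFree 4 := by
  classical
  intro s hs
  obtain ⟨a, t, ha, rfl, ht⟩ := Finset.card_eq_succ.1 hs.card_eq
  obtain ⟨b, c, d, hbc, hbd, hcd, rfl⟩ := Finset.card_eq_three.1 ht
  have hadj : ∀ {p q}, p ∈ insert a ({b, c, d} : Finset V) → q ∈ insert a ({b, c, d} : Finset V) →
      p ≠ q → G.Adj p q :=
    fun hp hq hpq => hs.isClique (Finset.mem_coe.2 hp) (Finset.mem_coe.2 hq) hpq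
  simp only [Finset.mem_insert, Finset.mem_singleton, not_or] at ha hadj
  exact h a b c d (hadj (by simp) (by simp) ha.1) (hadj (by simp) (by simp) ha.2.1)
    (hadj (by simp) (by simp) ha.2.2) (hadj (by simp) (by simp) hbc)
    (hadj (by simp) (by simp) hbd) (hadj (by simp) (by simp) hcd)

theorem LinkGraph.IsCompletion.exists_triangle {V : Type} {L : LinkGraph V}
    {T G : SimpleGraph V} (hT : L.IsCompletion T) (hG : IsChordal G) (hle : L.tot ≤ G)
    {a b c : V} (hab : T.Adj a b) (hbc : T.Adj b c) (hac : T.Adj a c) :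
    ∃ p q r, G.Adj p q ∧ G.Adj p r ∧ G.Adj q r := by
  have key : ∀ {x y z}, L.Good T x y z → L.NonBridge x y →
      ∃ p q r, G.Adj p q ∧ G.Adj p r ∧ G.Adj q r := by
    intro x y z h1 h2
    have hxy : L.tot.Adj x y := h1.elim .inl (fun h => h.1)
    obtain ⟨c, h3, h4⟩ := hG.exists_common_nbr (hle hxy)
      ((h2 hxy).mono (SimpleGraph.deleteEdges_mono hle))
    exact ⟨x, y, c, hle hxy, h3, h4.symm⟩
  obtain ⟨h | h | h, h1, h2, h3⟩ := hT.tri a b c hab hbc hac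
  · exact key h h1
  · exact key h h2
  · exact key h h3

theorem LinkGraph.IsCompletion.cliqueNumber_le {V : Type} [Finite V] {L : LinkGraph V}
    {T G : SimpleGraph V} (hT : L.IsCompletion T) (hG : IsChordal G) (hle : L.tot ≤ G) :
    cliqueNumber T ≤ cliqueNumber G := by
  classical
  by_cases h3 : T.CliqueFree 3
  · by_cases h2 : T.CliqueFree 2
    · by_cases h1 : T.CliqueFree 1
      · exact (_root_.cliqueNumber_le h1).trans (Nat.zero_le _)
      · obtain ⟨s, hs⟩ := not_forall_not.1 h1
        obtain ⟨v, rfl⟩ := SimpleGraph.isNClique_one.1 hs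
        exact (_root_.cliqueNumber_le h2).trans
          (le_cliqueNumber (s := {v}) (SimpleGraph.isNClique_one.2 ⟨v, rfl⟩))
    · rw [SimpleGraph.cliqueFree_two, ← ne_eq, SimpleGraph.ne_bot_iff_exists_adj] at h2
      obtain ⟨a, b, hab⟩ := h2
      obtain ⟨c, hac⟩ := hT.supp a b hab
      refine (_root_.cliqueNumber_le h3).trans (le_cliqueNumber (s := {a, c}) ?_)
      rw [SimpleGraph.isNClique_iff, Finset.card_pair hac.ne]
      exact ⟨by simpa using fun _ => hle hac, rfl⟩
  · obtain ⟨s, hs⟩ := not_forall_not.1 h3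
    obtain ⟨a, b, c, hab, hac, hbc, -⟩ := SimpleGraph.is3Clique_iff.1 hs
    obtain ⟨p, q, r, hpq, hpr, hqr⟩ := hT.exists_triangle hG hle hab hbc hac
    exact (_root_.cliqueNumber_le hT.noK4.cliqueFree).trans
      (le_cliqueNumber (SimpleGraph.is3Clique_iff.2 ⟨p, q, r, hpq, hpr, hqr, rfl⟩))

theorem LinkGraph.exists_isCompletion_of_simpleGraph {V : Type} [Fintype V] {G : SimpleGraph V}
    (htw : treewidth G ≤ 2) (hX : ¬ IsInducedMinor graphX G) :
    ∃ T, (⟨G, fun _ => ⊥⟩ : LinkGraph V).IsCompletion T := by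
  have htot : (⟨G, fun _ => ⊥⟩ : LinkGraph V).tot = G := by
    ext a b
    simp [tot_adj]
  refine exists_isCompletion (htot.symm ▸ hasWidthTwo_of_treewidth htw) fun h => hX ?_
  exact (h.trans (expand_bot G)).isInducedMinor exists_graphX_adj

/-- Every connected `X`-induced-minor-free graph of treewidth at most 2
admits a special minimum chordal completion, whose maximum clique has size at
most 3. -/
theorem stmt16 {V : Type} [Fintype V] (G : SimpleGraph V) (hc : G.Connected)
    (htw : treewidth G ≤ 2) (hX : ¬ IsInducedMinor graphX G) :
    ∃ Gt : SimpleGraph V, IsSpecialMCC G Gt ∧ cliqueNumber Gt ≤ 3 := by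
  obtain ⟨T, hT⟩ := LinkGraph.exists_isCompletion_of_simpleGraph htw hX
  have htot : ∀ {a b}, (⟨G, fun _ => ⊥⟩ : LinkGraph V).tot.Adj a b ↔ G.Adj a b := by
    simp [LinkGraph.tot_adj]
  refine ⟨T, ⟨⟨fun a b h => hT.le a b (htot.2 h), hT.dirac.isChordal, fun G'' h1 h2 =>
    hT.cliqueNumber_le h2 fun a b h => h1 (htot.1 h)⟩, ?_⟩, cliqueNumber_le hT.noK4.cliqueFree⟩
  rintro a b c - - - h1 h2 h3 ⟨hab, hbc, hac⟩
  have hgood : ∀ {x y z}, LinkGraph.Good ⟨G, fun _ => ⊥⟩ T x y z → G.Adj x y := fun h =>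
    h.elim id fun h => htot.1 h.1
  exact (hT.tri a b c hab hbc hac).1.elim (fun h => h1 (hgood h)) fun h =>
    h.elim (fun h => h2 (hgood h)) fun h => h3 (hgood h)
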